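/- arXiv:1504.02287 — 12 statements merged into one kernel-verified Lean document; each statement's English description precedes it below -/
import Mathlib

section
/- Let k be an infinite field, 𝒜 a finite-dimensional unital associative k-algebra, and A a finite subset of 𝒜 containing at least one invertible element of 𝒜. Then the k-vector subspace k⟨A⟩ spanned by A admits a k-basis consisting entirely of invertible elements of 𝒜. -/
open Polynomial in
/-- An algebraic element of an algebra over a field has finite spectrum. -/
theorem spectrum_finite_of_isIntegral {k A : Type*} [Field k] [Ring A] [Algebra k A]
    {a : A} (ha : IsIntegral k a) : (spectrum k a).Finite := by
  nontriviality A
  refine ((minpoly k a).rootSet_finite k).subset fun t ht => ?_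
  rw [mem_rootSet]
  refine ⟨minpoly.ne_zero ha, ?_⟩
  have h := spectrum.subset_polynomial_aeval a (minpoly k a) ⟨t, ht, rfl⟩
  rw [minpoly.aeval, spectrum.zero_eq] at h
  simpa [coe_aeval_eq_eval] using h

/-- In an integral algebra over an infinite field, for every unit `u` and element `a`, some
`t • u - a` with `t` a scalar is a unit. -/
theorem exists_isUnit_smul_sub {k A : Type*} [Field k] [Infinite k] [Ring A] [Algebra k A]
    [Algebra.IsIntegral k A] {u : A} (hu : IsUnit u) (a : A) :
    ∃ t : k, IsUnit (t • u - a) := by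
  obtain ⟨u, rfl⟩ := hu
  obtain ⟨t, ht⟩ := (spectrum_finite_of_isIntegral
    (Algebra.IsIntegral.isIntegral (R := k) (a * ↑u⁻¹))).exists_notMem
  refine ⟨t, ?_⟩
  have h := (spectrum.notMem_iff.mp ht).mul u.isUnit
  rwa [sub_mul, Units.inv_mul_cancel_right, ← Algebra.smul_def] at h

/-- In an integral algebra over an infinite field, a subspace containing a unit is
spanned by the units it contains. -/
theorem Submodule.span_isUnit_eq_of_exists_isUnit {k A : Type*} [Field k] [Infinite k] [Ring A]
    [Algebra k A] [Algebra.IsIntegral k A] (V : Submodule k A) (hV : ∃ u ∈ V, IsUnit u) :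
    span k {b | b ∈ V ∧ IsUnit b} = V := by
  obtain ⟨u, huV, hu⟩ := hV
  refine le_antisymm (span_le.mpr fun b hb => hb.1) fun a ha => ?_
  obtain ⟨t, ht⟩ := exists_isUnit_smul_sub (k := k) hu a
  rw [← sub_sub_cancel (t • u) a]
  exact sub_mem (smul_mem _ t (subset_span ⟨huV, hu⟩))
    (subset_span ⟨sub_mem (smul_mem _ t huV) ha, ht⟩)

theorem stmt_3 {k A : Type*} [Field k] [Infinite k] [Ring A] [Algebra k A]
    [FiniteDimensional k A]
    (S : Set A) (hSfin : S.Finite) (hinv : ∃ s ∈ S, IsUnit s) :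
    ∃ B : Set A, B ⊆ ↑(Submodule.span k S) ∧ (∀ b ∈ B, IsUnit b) ∧
      LinearIndependent k (fun b : B => (b : A)) ∧
      Submodule.span k B = Submodule.span k S := by
  obtain ⟨s, hs, hsu⟩ := hinv
  obtain ⟨B, hB, hspan, hli⟩ :=
    exists_linearIndependent k {b | b ∈ Submodule.span k S ∧ IsUnit b}
  exact ⟨B, fun b hb => (hB hb).1, fun b hb => (hB hb).2, hli, hspan.trans
    (Submodule.span_isUnit_eq_of_exists_isUnit _ ⟨s, Submodule.subset_span hs, hsu⟩)⟩
end

section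
/- Let k be an infinite field, 𝒜 a finite-dimensional unital associative k-algebra, and V an n-dimensional k-subspace of 𝒜 with a basis {x₁,…,xₙ} such that x₁ is invertible. For α ∈ k set x_α = x₁ + α x₂ + ⋯ + α^{n−1} xₙ. Then: (1) for any n pairwise distinct scalars α₁,…,αₙ ∈ k, the vectors x_{α₁},…,x_{αₙ} form a k-basis of V; (2) the set {α ∈ k : x_α is not invertible in 𝒜} is finite; consequently (3) there exist n pairwise distinct scalars α₁,…,αₙ ∈ k such that x_{α₁},…,x_{αₙ} is a basis of V consisting of invertible elements. -/
/-- Moments of a linearly independent family at pairwise distinct scalars are linearly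
independent. -/
theorem linearIndependent_sum_pow_smul {k M : Type*} [Field k] [AddCommGroup M] [Module k M]
    {n : ℕ} {x : Fin n → M} (hx : LinearIndependent k x) {α : Fin n → k}
    (hα : Function.Injective α) :
    LinearIndependent k (fun i : Fin n => ∑ j : Fin n, α i ^ (j : ℕ) • x j) := by
  rw [Fintype.linearIndependent_iff] at hx ⊢
  intro g hg
  have hsum : ∑ j : Fin n, (∑ i : Fin n, g i * α i ^ (j : ℕ)) • x j = 0 := by
    simp_rw [Finset.sum_smul, mul_smul]
    rw [Finset.sum_comm]
    simpa only [Finset.smul_sum] using hg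
  exact congrFun (Matrix.eq_zero_of_forall_pow_sum_mul_pow_eq_zero hα (hx _ hsum))

theorem span_sum_pow_smul {k M : Type*} [Field k] [AddCommGroup M] [Module k M]
    {n : ℕ} {x : Fin n → M} (hx : LinearIndependent k x) {α : Fin n → k}
    (hα : Function.Injective α) :
    Submodule.span k (Set.range fun i : Fin n => ∑ j : Fin n, α i ^ (j : ℕ) • x j) =
      Submodule.span k (Set.range x) := by
  have := FiniteDimensional.span_of_finite k (Set.finite_range x)
  apply Submodule.eq_of_le_of_finrank_eq
  · rw [Submodule.span_le]
    rintro _ ⟨i, rfl⟩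
    exact Submodule.sum_mem _ fun j _ =>
      Submodule.smul_mem _ _ (Submodule.subset_span ⟨j, rfl⟩)
  · rw [finrank_span_eq_card (linearIndependent_sum_pow_smul hx hα), finrank_span_eq_card hx]

/-- An element of a finite-dimensional algebra is a unit if and only if its left multiplication
matrix has nonzero determinant. -/
theorem isUnit_iff_det_leftMulMatrix_ne_zero {k A ι : Type*} [Field k] [Ring A] [Algebra k A]
    [Fintype ι] [DecidableEq ι] (b : Module.Basis ι k A) (a : A) :
    IsUnit a ↔ (Algebra.leftMulMatrix b a).det ≠ 0 := by
  rw [← isUnit_iff_ne_zero, ← Matrix.isUnit_iff_isUnit_det, ← Algebra.lmul_isUnit_iff (R := k)]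
  exact (MulEquiv.isUnit_map (LinearMap.toMatrixAlgEquiv b)).symm

/-- If the constant term of a polynomial curve in a finite-dimensional algebra is a unit, then
all but finitely many of its values are units. -/
theorem finite_setOf_not_isUnit_sum_pow_smul {k A : Type*} [Field k] [Ring A] [Algebra k A]
    [FiniteDimensional k A] {n : ℕ} (hn : 0 < n) (x : Fin n → A) (hx : IsUnit (x ⟨0, hn⟩)) :
    {α : k | ¬ IsUnit (∑ j : Fin n, α ^ (j : ℕ) • x j)}.Finite := by
  let b := Module.finBasis k A
  let p : Polynomial k :=
    (∑ j : Fin n, (Polynomial.X : Polynomial k) ^ (j : ℕ) •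
      (Algebra.leftMulMatrix b (x j)).map Polynomial.C).det
  have heval (α : k) :
      p.eval α = (Algebra.leftMulMatrix b (∑ j : Fin n, α ^ (j : ℕ) • x j)).det := by
    rw [← Polynomial.coe_evalRingHom, RingHom.map_det]
    congr 1
    ext r s
    simp [Matrix.sum_apply]
    simp only [mul_comm]
  have hzero : ∑ j : Fin n, (0 : k) ^ (j : ℕ) • x j = x ⟨0, hn⟩ := by
    rw [Finset.sum_eq_single ⟨0, hn⟩]
    · simp
    · intro j _ hj
      rw [zero_pow (fun h => hj (Fin.ext h)), zero_smul]
    · simp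
  have hp : p ≠ 0 := by
    intro h
    rw [← hzero, isUnit_iff_det_leftMulMatrix_ne_zero b, ← heval, h] at hx
    simp at hx
  refine (Polynomial.finite_setOfPred_isRoot hp).subset fun α hα => ?_
  rw [Set.mem_ofPred_eq, isUnit_iff_det_leftMulMatrix_ne_zero b, not_not, ← heval] at hα
  exact hα

theorem stmt_4 {k A : Type*} [Field k] [Infinite k] [Ring A] [Algebra k A]
    [FiniteDimensional k A]
    (n : ℕ) (hn : 0 < n) (V : Submodule k A) (x : Fin n → A)
    (hli : LinearIndependent k x)
    (hspan : Submodule.span k (Set.range x) = V)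
    (hx1 : IsUnit (x ⟨0, hn⟩)) :
    (∀ α : Fin n → k, Function.Injective α →
      LinearIndependent k (fun i : Fin n => ∑ j : Fin n, α i ^ (j : ℕ) • x j) ∧
      Submodule.span k (Set.range (fun i : Fin n => ∑ j : Fin n, α i ^ (j : ℕ) • x j)) = V) ∧
    {α : k | ¬ IsUnit (∑ j : Fin n, α ^ (j : ℕ) • x j)}.Finite ∧
    (∃ α : Fin n → k, Function.Injective α ∧
      (∀ i : Fin n, IsUnit (∑ j : Fin n, α i ^ (j : ℕ) • x j)) ∧
      LinearIndependent k (fun i : Fin n => ∑ j : Fin n, α i ^ (j : ℕ) • x j) ∧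
      Submodule.span k (Set.range (fun i : Fin n => ∑ j : Fin n, α i ^ (j : ℕ) • x j)) = V) := by
  subst hspan
  have hfin := finite_setOf_not_isUnit_sum_pow_smul (k := k) hn x hx1
  refine ⟨fun α hα => ⟨linearIndependent_sum_pow_smul hli hα, span_sum_pow_smul hli hα⟩, hfin, ?_⟩
  have := hfin.infinite_compl.to_subtype
  let e := (Fin.valEmbedding (n := n)).trans (Infinite.natEmbedding ↥{α : k |
    ¬ IsUnit (∑ j : Fin n, α ^ (j : ℕ) • x j)}ᶜ)
  have he : Function.Injective fun i => (e i : k) := Subtype.val_injective.comp e.injective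
  exact ⟨fun i => e i, he, fun i => not_not.mp (e i).2,
    linearIndependent_sum_pow_smul hli he, span_sum_pow_smul hli he⟩
end

section
/- Let k be an infinite field and 𝒜 a finite-dimensional unital associative k-algebra having only finitely many unital subalgebras. Then there exists x ∈ 𝒜 such that 𝒜 = k[x], i.e., the unital subalgebra generated by x is all of 𝒜. In particular, 𝒜 is commutative. -/
theorem exists_adjoin_singleton_eq_top_of_finite_subalgebra {k A : Type*} [Field k] [Infinite k]
    [Ring A] [Algebra k A] [Finite (Subalgebra k A)] :
    ∃ x : A, Algebra.adjoin k {x} = ⊤ := by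
  let p : Set.range (fun x : A ↦ Algebra.adjoin k {x}) → Submodule k A :=
    fun S ↦ Subalgebra.toSubmodule S.1
  have hcover : ⋃ S, (p S : Set A) = Set.univ :=
    Set.eq_univ_of_forall fun x ↦ Set.mem_iUnion.2
      ⟨⟨_, x, rfl⟩, Algebra.self_mem_adjoin_singleton k x⟩
  obtain ⟨⟨_, x, rfl⟩, hx⟩ := Subspace.exists_eq_top_of_iUnion_eq_univ hcover
  exact ⟨x, Algebra.toSubmodule_eq_top.1 hx⟩

theorem stmt_5 {k A : Type*} [Field k] [Infinite k] [Ring A] [Algebra k A]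
    [FiniteDimensional k A] (hfin : Finite (Subalgebra k A)) :
    (∃ x : A, Algebra.adjoin k {x} = ⊤) ∧ (∀ a b : A, a * b = b * a) := by
  obtain ⟨x, hx⟩ := exists_adjoin_singleton_eq_top_of_finite_subalgebra (k := k) (A := A)
  refine ⟨⟨x, hx⟩, fun a b ↦ ?_⟩
  have hmem (c : A) : c ∈ Algebra.adjoin k {x} := hx ▸ Algebra.mem_top
  have := Algebra.isMulCommutative_adjoin k (s := {x}) (by simp)
  exact congrArg Subtype.val (mul_comm' (⟨a, hmem a⟩ : Algebra.adjoin k {x}) ⟨b, hmem b⟩)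
end

section
/- Let k be an infinite field and n ≥ 4 an integer. Then the quotient algebra k[T]/(Tⁿ) has infinitely many unital k-subalgebras. (Explicitly, for distinct λ, μ ∈ k the subalgebras generated by T² + λT³ and by T² + μT³ are distinct, when n = 4.) -/
open Polynomial in
/-- The polynomials `p` with `p.coeff 1 = 0` and `p.coeff 3 = l * p.coeff 2`. -/
def cuspSubalgebra {k : Type*} [CommRing k] (l : k) : Subalgebra k k[X] where
  carrier := {p | p.coeff 1 = 0 ∧ p.coeff 3 = l * p.coeff 2}
  mul_mem' := by
    rintro p q ⟨hp1, hp3⟩ ⟨hq1, hq3⟩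
    simp only [Set.mem_ofPred_eq, coeff_mul, Finset.Nat.sum_antidiagonal_eq_sum_range_succ_mk,
      Finset.sum_range_succ, Finset.sum_range_zero]
    simp only [Nat.sub_self, Nat.sub_zero, Nat.reduceSub, hp1, hp3, hq1, hq3]
    constructor <;> ring
  add_mem' := by
    rintro p q ⟨hp1, hp3⟩ ⟨hq1, hq3⟩
    simp [hp1, hp3, hq1, hq3, mul_add]
  algebraMap_mem' r := by
    simp

open Polynomial in
theorem mem_cuspSubalgebra_of_mk_mem_adjoin {k : Type*} [CommRing k] {n : ℕ} (hn : 4 ≤ n)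
    {l : k} {p : k[X]}
    (hp : Ideal.Quotient.mk (Ideal.span {(X : k[X]) ^ n}) p ∈
      Algebra.adjoin k {Ideal.Quotient.mk (Ideal.span {(X : k[X]) ^ n}) (X ^ 2 + C l * X ^ 3)}) :
    p ∈ cuspSubalgebra l := by
  have hle : Algebra.adjoin k
      {Ideal.Quotient.mk (Ideal.span {(X : k[X]) ^ n}) (X ^ 2 + C l * X ^ 3)} ≤
      (cuspSubalgebra l).map (Ideal.Quotient.mkₐ k (Ideal.span {(X : k[X]) ^ n})) := by
    rw [Algebra.adjoin_le_iff, Set.singleton_subset_iff]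
    refine ⟨_, ?_, rfl⟩
    change _ ∧ _
    simp [coeff_X_pow]
  obtain ⟨q, ⟨hq1, hq3⟩, hqp⟩ := hle hp
  have hdvd : X ^ n ∣ q - p :=
    Ideal.mem_span_singleton.mp ((Ideal.Quotient.mk_eq_mk_iff_sub_mem q p).mp hqp)
  have hcoeff (d : ℕ) (hd : d < 4) : q.coeff d = p.coeff d := by
    simpa [sub_eq_zero] using X_pow_dvd_iff.mp hdvd d (by lia)
  rw [hcoeff 1 (by simp)] at hq1
  rw [hcoeff 3 (by simp), hcoeff 2 (by simp)] at hq3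
  exact ⟨hq1, hq3⟩

open Polynomial in
theorem adjoin_mk_X_sq_add_injective (k : Type*) [CommRing k] {n : ℕ} (hn : 4 ≤ n) :
    Function.Injective fun l : k ↦ Algebra.adjoin k
      {Ideal.Quotient.mk (Ideal.span {(X : k[X]) ^ n}) (X ^ 2 + C l * X ^ 3)} := by
  intro l m h
  have hl : X ^ 2 + C l * X ^ 3 ∈ cuspSubalgebra m :=
    mem_cuspSubalgebra_of_mk_mem_adjoin hn
      (h.le (Algebra.subset_adjoin (Set.mem_singleton _)))
  simpa [coeff_X_pow] using hl.2

theorem stmt_6 (k : Type*) [Field k] [Infinite k] (n : ℕ) (hn : 4 ≤ n) :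
    Infinite (Subalgebra k (Polynomial k ⧸ Ideal.span {(Polynomial.X : Polynomial k) ^ n})) ∧
    (n = 4 → ∀ l m : k, l ≠ m →
      Algebra.adjoin k {Ideal.Quotient.mk (Ideal.span {(Polynomial.X : Polynomial k) ^ n})
          (Polynomial.X ^ 2 + Polynomial.C l * Polynomial.X ^ 3)} ≠
      Algebra.adjoin k {Ideal.Quotient.mk (Ideal.span {(Polynomial.X : Polynomial k) ^ n})
          (Polynomial.X ^ 2 + Polynomial.C m * Polynomial.X ^ 3)}) :=
  ⟨Infinite.of_injective _ (adjoin_mk_X_sq_add_injective k hn),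
    fun _ _ _ hlm ↦ (adjoin_mk_X_sq_add_injective k hn).ne hlm⟩
end

section
/- Let k be an infinite field and P ∈ k[T] a polynomial with deg P ≥ 2. Then the quotient algebra k[T]/(P²) has infinitely many unital k-subalgebras. (Explicitly, for distinct λ, μ ∈ k, the subalgebras generated by (1+λT)P and by (1+μT)P are distinct two-dimensional subalgebras.) -/
set_option synthInstance.maxHeartbeats 400000

open Polynomial in
theorem Polynomial.eq_zero_of_sq_dvd_add_linear_mul {k : Type*} [Field k] {P : k[X]}
    (hP : 2 ≤ P.natDegree) {a b c : k} (h : P ^ 2 ∣ C a + (C b + C c * X) * P) :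
    a = 0 ∧ b = 0 ∧ c = 0 := by
  have hP0 : P ≠ 0 := by rintro rfl; simp at hP
  have ha : P ∣ C a :=
    (dvd_add_left (dvd_mul_left P _)).1 ((dvd_pow_self P two_ne_zero).trans h)
  have ha0 : C a = 0 := eq_zero_of_dvd_of_natDegree_lt ha (by rw [natDegree_C]; omega)
  rw [ha0, zero_add, pow_two, mul_dvd_mul_iff_right hP0, add_comm] at h
  have hbc := eq_zero_of_dvd_of_natDegree_lt h (natDegree_linear_le.trans_lt (by omega))
  refine ⟨by simpa using ha0, ?_, ?_⟩
  · simpa using congrArg (fun p => coeff p 0) hbc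
  · simpa using congrArg (fun p => coeff p 1) hbc

theorem Algebra.toSubmodule_adjoin_singleton_of_mul_self_eq_zero {k A : Type*} [CommRing k]
    [CommRing A] [Algebra k A] {x : A} (hx : x * x = 0) :
    Subalgebra.toSubmodule (Algebra.adjoin k {x}) = Submodule.span k {1, x} := by
  apply le_antisymm
  · intro y (hy : y ∈ Algebra.adjoin k {x})
    rw [Submodule.mem_span_pair]
    induction hy using Algebra.adjoin_induction with
    | mem y hy => exact ⟨0, 1, by simp [Set.mem_singleton_iff.1 hy]⟩
    | algebraMap r => exact ⟨r, 0, by simp [Algebra.smul_def]⟩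
    | add y z _ _ ihy ihz =>
      obtain ⟨a, b, rfl⟩ := ihy
      obtain ⟨c, d, rfl⟩ := ihz
      exact ⟨a + c, b + d, by module⟩
    | mul y z _ _ ihy ihz =>
      obtain ⟨a, b, rfl⟩ := ihy
      obtain ⟨c, d, rfl⟩ := ihz
      refine ⟨a * c, a * d + b * c, ?_⟩
      simp only [Algebra.smul_def, map_mul, map_add]
      linear_combination (-algebraMap k A b * algebraMap k A d) * hx
  · rw [Submodule.span_le, Set.insert_subset_iff, Set.singleton_subset_iff]
    exact ⟨one_mem (Algebra.adjoin k {x}), Algebra.self_mem_adjoin_singleton k x⟩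

theorem stmt_7 (k : Type*) [Field k] [Infinite k] (P : Polynomial k) (hP : 2 ≤ P.natDegree) :
    Infinite (Subalgebra k (Polynomial k ⧸ Ideal.span {P ^ 2})) ∧
    (∀ l m : k, l ≠ m →
      Algebra.adjoin k {Ideal.Quotient.mk (Ideal.span {P ^ 2})
          ((1 + Polynomial.C l * Polynomial.X) * P)} ≠
      Algebra.adjoin k {Ideal.Quotient.mk (Ideal.span {P ^ 2})
          ((1 + Polynomial.C m * Polynomial.X) * P)}) ∧
    (∀ l : k, Module.finrank k
      (Algebra.adjoin k {Ideal.Quotient.mk (Ideal.span {P ^ 2})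
          ((1 + Polynomial.C l * Polynomial.X) * P)}) = 2) := by
  set π := Ideal.Quotient.mk (Ideal.span {P ^ 2}) with hπ
  have hsmul (a : k) (Q : Polynomial k) : a • π Q = π (Polynomial.C a * Q) := by
    rw [← Polynomial.smul_eq_C_mul]; rfl
  have hone : (1 : Polynomial k ⧸ Ideal.span {P ^ 2}) = π 1 := (map_one π).symm
  have hzero (Q : Polynomial k) : π Q = 0 ↔ P ^ 2 ∣ Q := by
    rw [hπ, Ideal.Quotient.eq_zero_iff_mem, Ideal.mem_span_singleton]
  have hspan (l : k) := Algebra.toSubmodule_adjoin_singleton_of_mul_self_eq_zero (k := k)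
    (x := π ((1 + Polynomial.C l * Polynomial.X) * P)) (by
      rw [← map_mul, hzero]
      exact ⟨(1 + Polynomial.C l * Polynomial.X) ^ 2, by ring⟩)
  have hne (l m : k) (hlm : l ≠ m) :
      Algebra.adjoin k {π ((1 + Polynomial.C l * Polynomial.X) * P)} ≠
      Algebra.adjoin k {π ((1 + Polynomial.C m * Polynomial.X) * P)} := by
    intro h
    have hmem := Algebra.self_mem_adjoin_singleton k
      (π ((1 + Polynomial.C l * Polynomial.X) * P))
    rw [h, ← Subalgebra.mem_toSubmodule, hspan, Submodule.mem_span_pair] at hmem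
    obtain ⟨a, b, hab⟩ := hmem
    rw [hone, hsmul, hsmul, ← map_add, ← sub_eq_zero, ← map_sub, hzero] at hab
    obtain ⟨-, hb, hc⟩ := Polynomial.eq_zero_of_sq_dvd_add_linear_mul hP
      (a := a) (b := b - 1) (c := b * m - l) (by
        convert hab using 1
        simp only [map_sub, map_mul, map_one]
        ring)
    exact hlm (by linear_combination m * hb - hc)
  refine ⟨?_, hne, fun l => ?_⟩
  · exact Infinite.of_injective
      (fun l => Algebra.adjoin k {π ((1 + Polynomial.C l * Polynomial.X) * P)})
      fun l m h => by_contra fun hlm => hne l m hlm h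
  · have hli : LinearIndependent k ![1, π ((1 + Polynomial.C l * Polynomial.X) * P)] := by
      rw [LinearIndependent.pair_iff]
      intro a b hab
      rw [hone, hsmul, hsmul, ← map_add, hzero] at hab
      obtain ⟨ha, hb, -⟩ := Polynomial.eq_zero_of_sq_dvd_add_linear_mul hP
        (a := a) (b := b) (c := b * l) (by
          convert hab using 1
          simp only [map_mul]
          ring)
      exact ⟨ha, hb⟩
    have hcard := finrank_span_eq_card hli
    rw [Matrix.range_cons_cons_empty, ← hspan] at hcard
    simpa using hcard
end

section
/- Let k be a field and 𝒜 a finite-dimensional unital associative k-algebra. Then 𝒜 has only finitely many unital subalgebras if and only if 𝒜 has only finitely many unital subalgebras generated by a single element, i.e., if and only if the set of subalgebras of the form k[y] with y ∈ 𝒜 is finite. -/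
/-- A subalgebra is determined by the singly generated subalgebras it contains. -/
theorem Subalgebra.injective_singly_generated_le (R A : Type*) [CommSemiring R] [Semiring A]
    [Algebra R A] :
    Function.Injective fun S : Subalgebra R A ↦
      {T : {T : Subalgebra R A | ∃ y : A, T = Algebra.adjoin R {y}} | T.1 ≤ S} := by
  intro S T h
  ext y
  have hy := Set.ext_iff.mp h ⟨Algebra.adjoin R {y}, y, rfl⟩
  simpa [Algebra.adjoin_le_iff] using hy

theorem stmt_9 {k A : Type*} [Field k] [Ring A] [Algebra k A] [FiniteDimensional k A] :
    Finite (Subalgebra k A) ↔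
      {S : Subalgebra k A | ∃ y : A, S = Algebra.adjoin k {y}}.Finite := by
  refine ⟨fun _ ↦ Set.toFinite _, fun h ↦ ?_⟩
  have := h.to_subtype
  exact Finite.of_injective _ (Subalgebra.injective_singly_generated_le k A)
end

section
/- Let k be a field, n ≥ 0 an integer, and for each i ∈ {1,…,n} let Lᵢ be a finite field extension of k that is generated over k by a single element. Let m ∈ {2,3}. Then the product k-algebra L₁ × ⋯ × Lₙ × k[T]/(Tᵐ) has only finitely many unital k-subalgebras. (The same conclusion holds for L₁ × ⋯ × Lₙ without the factor k[T]/(Tᵐ).) -/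
/-- A field extension generated by one algebraic element has finitely many subalgebras. -/
theorem finite_subalgebra_of_adjoin_singleton_eq_top {k L : Type*} [Field k] [Field L]
    [Algebra k L] [FiniteDimensional k L] (h : ∃ x : L, Algebra.adjoin k {x} = ⊤) :
    Finite (Subalgebra k L) := by
  obtain ⟨x, hx⟩ := h
  have : Finite (IntermediateField k L) := by
    refine (Field.exists_primitive_element_iff_finite_intermediateField k L).1
      ⟨inferInstance, x, ?_⟩
    apply IntermediateField.toSubalgebra_injective
    rw [IntermediateField.adjoin_simple_toSubalgebra_of_isAlgebraic
      (Algebra.IsAlgebraic.isAlgebraic x), hx, IntermediateField.top_toSubalgebra]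
  exact Finite.of_equiv _ (subalgebraEquivIntermediateField (K := k) (L := L)).toEquiv.symm

/-- An algebra spanned by `1, t, t ^ 2` for some `t` with `t ^ 3 = 0` has finitely many
subalgebras: such a subalgebra is determined by whether it contains `t` and `t ^ 2`. -/
theorem finite_subalgebra_of_cube_eq_zero {k B : Type*} [Field k] [CommRing B] [Algebra k B]
    (t : B) (ht : t ^ 3 = 0)
    (hspan : ∀ x : B, ∃ a b c : k, x = algebraMap k B a + b • t + c • t ^ 2) :
    Finite (Subalgebra k B) := by
  have coeff_eq_zero (S : Subalgebra k B) (hS : t ∉ S) (a b c : k)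
      (h : algebraMap k B a + b • t + c • t ^ 2 ∈ S) : b = 0 := by
    by_contra hb
    have hu : b • t + c • t ^ 2 ∈ S := by
      simpa [add_assoc] using S.sub_mem h (S.algebraMap_mem a)
    have hu2 : b • b • t ^ 2 ∈ S := by
      convert S.mul_mem hu hu using 1
      simp only [Algebra.smul_def]
      linear_combination (-2 * algebraMap k B b * algebraMap k B c
        - algebraMap k B c ^ 2 * t) * ht
    have ht2 : t ^ 2 ∈ S := by
      simpa [smul_smul, hb] using S.smul_mem (S.smul_mem hu2 b⁻¹) b⁻¹
    have hbt : b • t ∈ S := by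
      simpa using S.sub_mem hu (S.smul_mem ht2 c)
    exact hS (by simpa [smul_smul, hb] using S.smul_mem hbt b⁻¹)
  have le_of_iff (S S' : Subalgebra k B) (h1 : t ∈ S ↔ t ∈ S') (h2 : t ^ 2 ∈ S ↔ t ^ 2 ∈ S') :
      S ≤ S' := by
    intro x hx
    obtain ⟨a, b, c, rfl⟩ := hspan x
    by_cases hS : t ∈ S
    · have hS' := h1.1 hS
      exact S'.add_mem (S'.add_mem (S'.algebraMap_mem a) (S'.smul_mem hS' b))
        (S'.smul_mem (S'.pow_mem hS' 2) c)
    · obtain rfl := coeff_eq_zero S hS a b c hx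
      by_cases hc : c = 0
      · simp [hc]
      have hct : c • t ^ 2 ∈ S := by
        simpa using S.sub_mem hx (S.algebraMap_mem a)
      have ht2 : t ^ 2 ∈ S := by simpa [smul_smul, hc] using S.smul_mem hct c⁻¹
      simpa using S'.add_mem (S'.algebraMap_mem a) (S'.smul_mem (h2.1 ht2) c)
  refine Finite.of_injective (β := Prop × Prop) (fun S => (t ∈ S, t ^ 2 ∈ S)) fun S S' h => ?_
  simp only [Prod.mk.injEq, eq_iff_iff] at h
  exact le_antisymm (le_of_iff S S' h.1 h.2) (le_of_iff S' S h.1.symm h.2.symm)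

/-- If `C` embeds into `B × L` with `B` finite-dimensional and `L` a finite field extension, and
`B` and `L` have finitely many subalgebras, then so does `C`. This is Goursat's lemma: a
subalgebra of `C` is either cut out by its images in `B` and `L`, or is the graph of
a homomorphism to `L` from its image in `B`. -/
theorem finite_subalgebra_of_jointly_injective {k B C L : Type*} [Field k] [CommRing B]
    [Algebra k B] [CommRing C] [Algebra k C] [Field L] [Algebra k L]
    [FiniteDimensional k B] [FiniteDimensional k L]
    [Finite (Subalgebra k B)] [Finite (Subalgebra k L)]
    (f : C →ₐ[k] B) (g : C →ₐ[k] L) (hfg : ∀ x y, f x = f y → g x = g y → x = y) :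
    Finite (Subalgebra k C) := by
  let Φ : (Subalgebra k B × Subalgebra k L) ⊕ (Σ S : Subalgebra k B, (S →ₐ[k] L)) → Set C :=
    Sum.elim (fun p => {x | f x ∈ p.1 ∧ g x ∈ p.2})
      (fun p => {x | ∃ hx : f x ∈ p.1, p.2 ⟨f x, hx⟩ = g x})
  suffices h : Set.range (fun A : Subalgebra k C => (A : Set C)) ⊆ Set.range Φ from
    Set.finite_range_iff SetLike.coe_injective |>.1 ((Set.finite_range Φ).subset h)
  rintro _ ⟨A, rfl⟩
  by_cases hA : ∃ a ∈ A, f a = 0 ∧ g a ≠ 0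
  · obtain ⟨a, ha, hfa, hga⟩ := hA
    refine ⟨Sum.inl (A.map f, A.map g), Set.ext fun x => ⟨?_, fun hx =>
      ⟨⟨x, hx, rfl⟩, ⟨x, hx, rfl⟩⟩⟩⟩
    rintro ⟨⟨y, hy, hyx⟩, hgx⟩
    have hy' : y ∈ A := hy
    have hinv : (g a)⁻¹ ∈ A.map g :=
      (A.map g).inv_mem_of_algebraic (x := ⟨g a, a, ha, rfl⟩)
        (Algebra.IsAlgebraic.isAlgebraic _)
    obtain ⟨w, hw, hwx⟩ := (A.map g).mul_mem hinv
      ((A.map g).sub_mem hgx ⟨y, hy, rfl⟩)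
    have hx : x = y + a * w := by
      refine hfg _ _ ?_ ?_
      · simpa [hfa] using hyx.symm
      · have hwx' : g w = (g a)⁻¹ * (g x - g y) := hwx
        rw [map_add, map_mul, hwx']
        field_simp
        ring
    rw [hx]
    exact A.add_mem hy' (A.mul_mem ha hw)
  · push Not at hA
    let F : A →ₐ[k] A.map f := f.subalgebraMap A
    have hF : Function.Surjective F := f.subalgebraMap_surjective A
    have hker : ∀ a ∈ RingHom.ker F, g.comp A.val a = 0 := fun a ha =>
      hA a a.2 (congrArg Subtype.val ha)
    let h : A.map f →ₐ[k] L := (Ideal.Quotient.liftₐ (RingHom.ker F) (g.comp A.val) hker).comp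
        (Ideal.quotientKerAlgEquivOfSurjective hF).symm.toAlgHom
    have hh (a : A) : h (F a) = g a := by
      have : (Ideal.quotientKerAlgEquivOfSurjective hF).symm (F a) = Ideal.Quotient.mk _ a := by
        rw [AlgEquiv.symm_apply_eq]
        rfl
      exact congrArg (Ideal.Quotient.liftₐ (RingHom.ker F) (g.comp A.val) hker) this
    refine ⟨Sum.inr ⟨A.map f, h⟩, Set.ext fun x => ⟨?_, fun hx => ⟨⟨x, hx, rfl⟩, hh ⟨x, hx⟩⟩⟩⟩
    rintro ⟨⟨y, hy, hyx⟩, hx⟩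
    have hy' : y ∈ A := hy
    have hyx' : f y = f x := hyx
    have hFy : F ⟨y, hy⟩ = ⟨f x, ⟨y, hy, hyx⟩⟩ := Subtype.ext hyx
    have hgy : g y = g x := by rw [← hx, ← hFy, hh]
    exact hfg y x hyx' hgy ▸ hy'

/-- Multiplying by finitely many simple finite field extensions preserves the finiteness of the
set of subalgebras. -/
theorem finite_subalgebra_pi_prod {k B : Type*} [Field k] [CommRing B] [Algebra k B]
    [FiniteDimensional k B] [Finite (Subalgebra k B)] (n : ℕ) (L : Fin n → Type*)
    [∀ i, Field (L i)] [∀ i, Algebra k (L i)] [∀ i, FiniteDimensional k (L i)]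
    (hgen : ∀ i, ∃ x : L i, Algebra.adjoin k {x} = ⊤) :
    Finite (Subalgebra k ((∀ i, L i) × B)) := by
  induction n with
  | zero =>
    refine Finite.of_injective (Subalgebra.map (AlgHom.snd k (∀ i, L i) B))
      (Subalgebra.map_injective fun x y hxy => Prod.ext (Subsingleton.elim _ _) hxy)
  | succ n ih =>
    have := ih (fun i => L i.succ) fun i => hgen i.succ
    have := finite_subalgebra_of_adjoin_singleton_eq_top (hgen 0)
    refine finite_subalgebra_of_jointly_injective (B := (∀ i : Fin n, L i.succ) × B) (L := L 0)
      (AlgHom.prod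
        ((AlgHom.pi fun i : Fin n => Pi.evalAlgHom k L i.succ).comp
          (AlgHom.fst k (∀ i, L i) B))
        (AlgHom.snd k (∀ i, L i) B))
      ((Pi.evalAlgHom k L 0).comp (AlgHom.fst k (∀ i, L i) B)) fun x y h1 h2 => ?_
    obtain ⟨h1, h3⟩ := Prod.ext_iff.1 h1
    refine Prod.ext (funext fun i => ?_) h3
    induction i using Fin.cases with
    | zero => exact h2
    | succ i => exact congrFun h1 i

open Polynomial in
/-- `k[X] / (X ^ m)` is spanned by `1, X, X ^ 2` if `m ≤ 3`. -/
theorem exists_eq_of_quotient_X_pow {k : Type*} [Field k] {m : ℕ} (hm : m ≤ 3)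
    (x : k[X] ⧸ Ideal.span {(X : k[X]) ^ m}) :
    ∃ a b c : k, x = algebraMap k _ a + b • Ideal.Quotient.mk _ X
      + c • Ideal.Quotient.mk _ X ^ 2 := by
  obtain ⟨p, rfl⟩ := Ideal.Quotient.mk_surjective x
  refine ⟨p.coeff 0, p.divX.coeff 0, p.divX.divX.coeff 0, ?_⟩
  have hp : p = C (p.coeff 0) + C (p.divX.coeff 0) * X + C (p.divX.divX.coeff 0) * X ^ 2
      + p.divX.divX.divX * X ^ 3 := by
    linear_combination -p.divX_mul_X_add - X * p.divX.divX_mul_X_add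
      - X ^ 2 * p.divX.divX.divX_mul_X_add
  have h3 : Ideal.Quotient.mk (Ideal.span {(X : k[X]) ^ m}) X ^ 3 = 0 := by
    rw [← map_pow, Ideal.Quotient.eq_zero_iff_mem, Ideal.mem_span_singleton]
    exact pow_dvd_pow X hm
  have hC (a : k) (q : k[X]) : Ideal.Quotient.mk (Ideal.span {(X : k[X]) ^ m}) (C a)
      * Ideal.Quotient.mk _ q = a • Ideal.Quotient.mk _ q := by
    rw [← map_mul, ← smul_eq_C_mul]
    rfl
  conv_lhs => rw [hp]
  rw [map_add, map_add, map_add, map_mul, map_mul, map_mul, map_pow _ X 3, h3, mul_zero, add_zero,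
    hC, hC, map_pow]
  rfl

theorem stmt_10 (k : Type*) [Field k] (n : ℕ) (L : Fin n → Type*)
    [∀ i, Field (L i)] [∀ i, Algebra k (L i)] [∀ i, FiniteDimensional k (L i)]
    (hgen : ∀ i, ∃ x : L i, Algebra.adjoin k {x} = ⊤)
    (m : ℕ) (hm : m = 2 ∨ m = 3) :
    Finite (Subalgebra k ((∀ i, L i) ×
      (Polynomial k ⧸ Ideal.span {(Polynomial.X : Polynomial k) ^ m}))) ∧
    Finite (Subalgebra k (∀ i, L i)) := by
  have hm3 : m ≤ 3 := by omega
  have : FiniteDimensional k (Polynomial k ⧸ Ideal.span {(Polynomial.X : Polynomial k) ^ m}) :=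
    (Polynomial.monic_X_pow m).finite_quotient
  have : Finite (Subalgebra k
      (Polynomial k ⧸ Ideal.span {(Polynomial.X : Polynomial k) ^ m})) := by
    refine finite_subalgebra_of_cube_eq_zero (Ideal.Quotient.mk _ Polynomial.X) ?_
      (exists_eq_of_quotient_X_pow hm3)
    rw [← map_pow, Ideal.Quotient.eq_zero_iff_mem, Ideal.mem_span_singleton]
    exact pow_dvd_pow _ hm3
  have hprod := finite_subalgebra_pi_prod
    (B := Polynomial k ⧸ Ideal.span {(Polynomial.X : Polynomial k) ^ m}) n L hgen
  refine ⟨hprod, Finite.of_injective (Subalgebra.comap (AlgHom.fst k (∀ i, L i)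
    (Polynomial k ⧸ Ideal.span {(Polynomial.X : Polynomial k) ^ m}))) fun S S' h => ?_⟩
  ext x
  exact SetLike.ext_iff.1 h (x, 0)
end

section
/- Let k be an infinite field and 𝒜 a finite-dimensional unital associative k-algebra. Let A and B be finite nonempty subsets of 𝒜∖{0} such that k⟨A⟩ and k⟨B⟩ each contain an invertible element of 𝒜, the elements of A pairwise commute, and the subalgebra 𝔸(A) generated by A has only finitely many unital subalgebras. Let ℋ = {h ∈ 𝒜 : h·k⟨AB⟩ ⊆ k⟨AB⟩} be the left stabilizer of k⟨AB⟩ (a subalgebra of 𝒜). Then dim_k k⟨AB⟩ ≥ dim_k k⟨A⟩ + dim_k k⟨B⟩ − dim_k ℋ. In particular, if ℋ = k then dim_k k⟨AB⟩ ≥ dim_k k⟨A⟩ + dim_k k⟨B⟩ − 1. -/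
open Pointwise

/-- In a finite-dimensional algebra, `u + t • v` is invertible for all but finitely many scalars `t`
as soon as `u` is invertible. -/
theorem finite_setOf_not_isUnit_add_smul {k A : Type*} [Field k] [Ring A] [Algebra k A]
    [FiniteDimensional k A] {u : A} (hu : IsUnit u) (v : A) :
    {t : k | ¬ IsUnit (u + t • v)}.Finite := by
  obtain ⟨u, rfl⟩ := hu
  set w : A := ↑u⁻¹ * v with hw
  have hspec : (spectrum k w).Finite := by
    refine ((minpoly k w).rootSet_finite k).subset fun t ht => ?_
    have hint : IsIntegral k w := IsIntegral.of_finite k w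
    have h0 : Polynomial.eval t (minpoly k w) ∈ spectrum k (Polynomial.aeval w (minpoly k w)) :=
      spectrum.subset_polynomial_aeval w _ ⟨t, ht, rfl⟩
    rw [minpoly.aeval, spectrum.mem_iff, sub_zero] at h0
    rw [Polynomial.mem_rootSet]
    refine ⟨minpoly.ne_zero hint, ?_⟩
    by_contra hne
    exact h0 ((IsUnit.mk0 _ (by simpa using hne)).map (algebraMap k A))
  refine (hspec.image fun s => -s⁻¹).subset fun t ht => ?_
  have ht0 : t ≠ 0 := by
    rintro rfl
    exact ht (by simp)
  refine ⟨-t⁻¹, fun hunit => ht ?_, by simp⟩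
  have key : (u : A) + t • v = u * ((algebraMap k A (-t)) * (algebraMap k A (-t⁻¹) - w)) := by
    rw [mul_sub, ← map_mul, ← Algebra.smul_def, hw]
    simp [ht0, mul_add]
  rw [key]
  exact u.isUnit.mul (((IsUnit.mk0 (-t) (neg_ne_zero.2 ht0)).map (algebraMap k A)).mul hunit)

/-- A subspace that contains an invertible element is spanned by its invertible elements. -/
theorem le_of_forall_isUnit_mem {k A : Type*} [Field k] [Infinite k] [Ring A] [Algebra k A]
    [FiniteDimensional k A] {Q W : Submodule k A} (hQ : ∃ u ∈ Q, IsUnit u)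
    (hW : ∀ e ∈ Q, IsUnit e → e ∈ W) : Q ≤ W := by
  obtain ⟨u, huQ, hu⟩ := hQ
  intro q hq
  obtain ⟨t, ht⟩ := ((finite_setOf_not_isUnit_add_smul (k := k) hu q).union
    (Set.finite_singleton 0)).exists_notMem
  simp only [Set.mem_union, Set.mem_ofPred_eq, Set.mem_singleton_iff, not_or, not_not] at ht
  have h1 := W.sub_mem (hW _ (Q.add_mem huQ (Q.smul_mem t hq)) ht.1) (hW u huQ hu)
  rw [add_sub_cancel_left] at h1
  exact (W.smul_mem_iff ht.2).1 h1

theorem finrank_map_of_injective {k M N : Type*} [Field k] [AddCommGroup M] [Module k M]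
    [AddCommGroup N] [Module k N] {f : M →ₗ[k] N} (hf : Function.Injective f)
    (p : Submodule k M) : Module.finrank k (p.map f) = Module.finrank k p :=
  (Submodule.equivMapOfInjective f hf p).finrank_eq.symm

/-- Diderrich's lemma for subspaces, normalized so that `1` lies in the commutative factor. -/
theorem exists_subalgebra_submodule_of_one_mem {k A : Type*} [Field k] [Infinite k] [Ring A]
    [Algebra k A] [FiniteDimensional k A] (P Q : Submodule k A) (h1 : (1 : A) ∈ P)
    (hQ : ∃ u ∈ Q, IsUnit u) (hcomm : ∀ a ∈ P, ∀ b ∈ P, a * b = b * a) :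
    ∃ (H : Subalgebra k A) (V : Submodule k A), H ≤ Algebra.adjoin k (P : Set A) ∧ Q ≤ V ∧
      V ≤ P * Q ∧ (∀ h ∈ H, ∀ v ∈ V, h * v ∈ V) ∧
      Module.finrank k P + Module.finrank k Q ≤ Module.finrank k V + Module.finrank k H := by
  induction hn : Module.finrank k P using Nat.strong_induction_on generalizing P Q with
  | _ n ih =>
  subst hn
  by_cases hstab : ∀ e ∈ Q, IsUnit e → ∀ x ∈ P, x * e ∈ Q
  · have hmul : ∀ x ∈ P, ∀ q ∈ Q, x * q ∈ Q := fun x hx q hq =>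
      le_of_forall_isUnit_mem (W := Q.comap (LinearMap.mulLeft k x)) hQ
        (fun e he heu => hstab e he heu x hx) hq
    refine ⟨Algebra.adjoin k (P : Set A), Q, le_rfl, le_rfl, fun q hq => ?_, fun h hh => ?_, ?_⟩
    · simpa using Submodule.mul_mem_mul h1 hq
    · induction hh using Algebra.adjoin_induction with
      | mem x hx => exact hmul x hx
      | algebraMap r =>
        intro q hq
        rw [← Algebra.smul_def]
        exact Q.smul_mem r hq
      | add x y _ _ hx hy =>
        intro q hq
        rw [add_mul]
        exact Q.add_mem (hx q hq) (hy q hq)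
      | mul x y _ _ hx hy =>
        intro q hq
        rw [mul_assoc]
        exact hx _ (hy q hq)
    · rw [add_comm]
      gcongr
      exact Submodule.finrank_mono
        (t := Subalgebra.toSubmodule (Algebra.adjoin k (P : Set A))) Algebra.subset_adjoin
  · push Not at hstab
    obtain ⟨e, heQ, heu, x, hxP, hxe⟩ := hstab
    set f : A →ₗ[k] A := LinearMap.mulRight k e with hf
    have hfinj : Function.Injective f := fun a b hab => heu.mul_left_injective hab
    set P' := P ⊓ Q.comap f with hP'
    set Q' := Q ⊔ P.map f with hQ'
    have hdim : Module.finrank k P' + Module.finrank k Q' =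
        Module.finrank k P + Module.finrank k Q := by
      have hsum := Submodule.finrank_sup_add_finrank_inf_eq Q (P.map f)
      have hinf : Q ⊓ P.map f = P'.map f := by
        ext y
        simp only [Submodule.mem_inf, Submodule.mem_map, hP', Submodule.mem_comap]
        constructor
        · rintro ⟨hy, x, hx, rfl⟩
          exact ⟨x, ⟨hx, hy⟩, rfl⟩
        · rintro ⟨x, ⟨hx, hy⟩, rfl⟩
          exact ⟨hy, x, hx, rfl⟩
      rw [hinf, finrank_map_of_injective hfinj, finrank_map_of_injective hfinj, ← hQ'] at hsum
      omega
    have hlt : Module.finrank k P' < Module.finrank k P :=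
      Submodule.finrank_lt_finrank_of_lt
        (lt_of_le_of_ne inf_le_left fun h => hxe ((h.ge hxP).2))
    obtain ⟨H, V, hH, hV, hVle, hHV, hle⟩ := ih _ hlt P' Q'
      ⟨h1, by simpa [hf] using heQ⟩ ⟨e, Submodule.mem_sup_left heQ, heu⟩
      (fun a ha b hb => hcomm a ha.1 b hb.1) rfl
    refine ⟨H, V, hH.trans (Algebra.adjoin_mono fun y hy => hy.1), le_sup_left.trans hV,
      hVle.trans ?_, hHV, by omega⟩
    rw [hQ', Submodule.mul_sup]
    refine sup_le (mul_le_mul_left inf_le_left _) (Submodule.mul_le.2 ?_)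
    rintro a ⟨haP, haQ⟩ _ ⟨b, hb, rfl⟩
    have : a * f b = b * f a := by
      simp only [hf, LinearMap.mulRight_apply, ← mul_assoc, hcomm a haP b hb]
    rw [this]
    exact Submodule.mul_mem_mul hb haQ

/-- A subalgebra of a finite-dimensional algebra contains the inverses of its units. -/
theorem Subalgebra.inv_mem_of_finiteDimensional {k A : Type*} [Field k] [Ring A] [Algebra k A]
    [FiniteDimensional k A] (K : Subalgebra k A) (u : Aˣ) (hu : (u : A) ∈ K) :
    ((u⁻¹ : Aˣ) : A) ∈ K := by
  have hinj : Function.Injective (LinearMap.mulLeft k (⟨u, hu⟩ : K)) := fun a b hab =>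
    Subtype.ext (u.isUnit.mul_right_injective (congrArg Subtype.val hab))
  obtain ⟨b, hb⟩ := LinearMap.injective_iff_surjective.1 hinj 1
  have hb' : (u : A) * b = 1 := congrArg Subtype.val hb
  rw [Units.inv_eq_of_mul_eq_one_right hb']
  exact b.2

/-- Diderrich's lemma for subspaces, at an invertible element of the commutative factor. -/
theorem exists_subalgebra_submodule_of_isUnit_mem {k A : Type*} [Field k] [Infinite k] [Ring A]
    [Algebra k A] [FiniteDimensional k A] (P Q : Submodule k A)
    (hQ : ∃ u ∈ Q, IsUnit u) (hcomm : ∀ a ∈ P, ∀ b ∈ P, a * b = b * a)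
    {a : A} (ha : a ∈ P) (hau : IsUnit a) :
    ∃ (H : Subalgebra k A) (V : Submodule k A), H ≤ Algebra.adjoin k (P : Set A) ∧
      (∀ q ∈ Q, a * q ∈ V) ∧ V ≤ P * Q ∧ (∀ h ∈ H, ∀ v ∈ V, h * v ∈ V) ∧
      Module.finrank k P + Module.finrank k Q ≤ Module.finrank k V + Module.finrank k H := by
  obtain ⟨u, rfl⟩ := hau
  set g : A →ₗ[k] A := LinearMap.mulLeft k (u : A) with hg
  set g' : A →ₗ[k] A := LinearMap.mulLeft k ((u⁻¹ : Aˣ) : A) with hg'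
  have hginj : Function.Injective g := u.isUnit.mul_right_injective
  have hginj' : Function.Injective g' := u⁻¹.isUnit.mul_right_injective
  have hinv : ∀ p ∈ P, Commute ((u⁻¹ : Aˣ) : A) p := fun p hp =>
    Commute.units_inv_left (hcomm _ ha p hp)
  obtain ⟨H, V, hH, hV, hVle, hHV, hle⟩ := exists_subalgebra_submodule_of_one_mem (P.map g') Q
    ⟨u, ha, by simp [hg']⟩ hQ (by
      rintro _ ⟨x, hx, rfl⟩ _ ⟨y, hy, rfl⟩
      have h1 : Commute x y := hcomm x hx y hy
      exact ((Commute.refl _).mul_right (hinv y hy)).mul_left ((hinv x hx).symm.mul_right h1))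
  have hHP : H ≤ Algebra.adjoin k (P : Set A) := by
    refine hH.trans (Algebra.adjoin_le ?_)
    rintro _ ⟨x, hx, rfl⟩
    exact mul_mem (Subalgebra.inv_mem_of_finiteDimensional _ u (Algebra.subset_adjoin ha))
      (Algebra.subset_adjoin hx)
  have hHu : ∀ h ∈ H, h * u = u * h := fun h hh =>
    (Algebra.commute_of_mem_adjoin_of_forall_mem_commute (hHP hh)
      fun b hb => hcomm _ ha b hb).symm
  refine ⟨H, V.map g, hHP, fun q hq => ⟨q, hV hq, rfl⟩, ?_, ?_, ?_⟩
  · rw [Submodule.map_le_iff_le_comap]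
    refine hVle.trans (Submodule.mul_le.2 ?_)
    rintro _ ⟨x, hx, rfl⟩ q hq
    simpa [hg, hg', mul_assoc] using Submodule.mul_mem_mul hx hq
  · rintro h hh _ ⟨v, hv, rfl⟩
    refine ⟨h * v, hHV h hh v hv, ?_⟩
    simp only [hg, LinearMap.mulLeft_apply, ← mul_assoc, hHu h hh]
  · rwa [finrank_map_of_injective hginj, ← finrank_map_of_injective hginj' P]

/-- Linear Kneser inequality for subspaces, one of which is commutative and generates an algebra
with finitely many subalgebras. -/
theorem exists_subalgebra_finrank_add_le {k A : Type*} [Field k] [Infinite k] [Ring A]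
    [Algebra k A] [FiniteDimensional k A] [Nontrivial A] (P Q : Submodule k A)
    (hP : ∃ u ∈ P, IsUnit u)
    (hQ : ∃ u ∈ Q, IsUnit u) (hcomm : ∀ a ∈ P, ∀ b ∈ P, a * b = b * a)
    (hfin : (Set.Iic (Algebra.adjoin k (P : Set A))).Finite) :
    ∃ H : Subalgebra k A, (∀ h ∈ H, ∀ x ∈ P * Q, h * x ∈ P * Q) ∧
      Module.finrank k P + Module.finrank k Q ≤
        Module.finrank k ↥(P * Q) + Module.finrank k H := by
  let C : Subalgebra k A → Set A := fun H => {a | a ∈ P ∧ IsUnit a ∧ ∃ V : Submodule k A,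
    (∀ q ∈ Q, a * q ∈ V) ∧ V ≤ P * Q ∧ (∀ h ∈ H, ∀ v ∈ V, h * v ∈ V) ∧
      Module.finrank k P + Module.finrank k Q ≤ Module.finrank k V + Module.finrank k H}
  have hC : ∀ a ∈ P, IsUnit a → ∃ H ∈ Set.Iic (Algebra.adjoin k (P : Set A)), a ∈ C H := by
    intro a ha hau
    obtain ⟨H, V, hH, hV⟩ := exists_subalgebra_submodule_of_isUnit_mem P Q hQ hcomm ha hau
    exact ⟨H, hH, ha, hau, V, hV⟩
  obtain ⟨u, huP, hu⟩ := hP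
  have hcover : ∀ v ∈ P, ∃ H ∈ Set.Iic (Algebra.adjoin k (P : Set A)),
      v ∈ Submodule.span k (C H) := by
    intro v hv
    have hinf : {t : k | IsUnit (u + t • v)}.Infinite := by
      have := (finite_setOf_not_isUnit_add_smul (k := k) hu v).infinite_compl
      simpa [Set.compl_ofPred] using this
    have hex : ∀ t : k, ∃ H, IsUnit (u + t • v) →
        H ∈ Set.Iic (Algebra.adjoin k (P : Set A)) ∧ u + t • v ∈ C H := fun t => by
      by_cases ht : IsUnit (u + t • v)
      · obtain ⟨H, hH⟩ := hC _ (P.add_mem huP (P.smul_mem t hv)) ht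
        exact ⟨H, fun _ => hH⟩
      · exact ⟨⊥, fun h => absurd h ht⟩
    choose F hF using hex
    obtain ⟨s, hs, t, ht, hst, hFst⟩ := hinf.exists_ne_map_eq_of_mapsTo
      (fun t ht => (hF t ht).1) hfin
    refine ⟨F s, (hF s hs).1, ?_⟩
    have hs' := Submodule.subset_span (R := k) (hF s hs).2
    have ht' := Submodule.subset_span (R := k) (hF t ht).2
    rw [← hFst] at ht'
    have hsub := Submodule.sub_mem _ hs' ht'
    rw [add_sub_add_left_eq_sub, ← sub_smul] at hsub
    exact (Submodule.smul_mem_iff _ (sub_ne_zero.2 hst)).1 hsub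
  obtain ⟨H, hH⟩ : ∃ H, P ≤ Submodule.span k (C H) := by
    have : Finite (Set.Iic (Algebra.adjoin k (P : Set A))) := hfin
    obtain ⟨H, hH⟩ := Subspace.exists_eq_top_of_iUnion_eq_univ (k := k) (E := P)
      (p := fun H : Set.Iic (Algebra.adjoin k (P : Set A)) =>
        (Submodule.span k (C H)).comap P.subtype) (by
      refine Set.eq_univ_of_forall fun v => ?_
      obtain ⟨H, hH, hv⟩ := hcover v v.2
      exact Set.mem_iUnion.2 ⟨⟨H, hH⟩, hv⟩)
    exact ⟨H, Submodule.comap_subtype_eq_top.1 hH⟩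
  have hCne : (C H).Nonempty := by
    by_contra hne
    rw [Set.not_nonempty_iff_eq_empty] at hne
    rw [hne, Submodule.span_empty] at hH
    exact hu.ne_zero (hH huP)
  refine ⟨H, fun h hh => ?_, ?_⟩
  · suffices P * Q ≤ (P * Q).comap (LinearMap.mulLeft k h) from this
    refine Submodule.mul_le.2 fun a ha q hq => ?_
    have : Submodule.span k (C H) ≤
        ((P * Q).comap (LinearMap.mulLeft k h)).comap (LinearMap.mulRight k q) := by
      refine Submodule.span_le.2 ?_
      rintro a ⟨-, -, V, hV, hVle, hHV, -⟩
      exact hVle (hHV h hh _ (hV q hq))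
    exact this (hH ha)
  · obtain ⟨a, -, -, V, -, hVle, -, hle⟩ := hCne
    exact hle.trans (Nat.add_le_add_right (Submodule.finrank_mono hVle) _)

theorem stmt_12 {k A : Type*} [Field k] [Infinite k] [Ring A] [Algebra k A]
    [FiniteDimensional k A]
    (S T : Set A) (hSfin : S.Finite) (hTfin : T.Finite)
    (hSne : S.Nonempty) (hTne : T.Nonempty)
    (hS0 : (0 : A) ∉ S) (hT0 : (0 : A) ∉ T)
    (hSu : ∃ x ∈ Submodule.span k S, IsUnit x) (hTu : ∃ x ∈ Submodule.span k T, IsUnit x)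
    (hcomm : ∀ a ∈ S, ∀ a' ∈ S, a * a' = a' * a)
    (hfin : Finite (Subalgebra k (Algebra.adjoin k S)))
    (H : Subalgebra k A)
    (hH : ∀ h : A, h ∈ H ↔
      ∀ x ∈ Submodule.span k (S * T), h * x ∈ Submodule.span k (S * T)) :
    Module.finrank k (Submodule.span k S) + Module.finrank k (Submodule.span k T) ≤
      Module.finrank k (Submodule.span k (S * T)) + Module.finrank k H ∧
    (H = ⊥ →
      Module.finrank k (Submodule.span k S) + Module.finrank k (Submodule.span k T) ≤
        Module.finrank k (Submodule.span k (S * T)) + 1) := by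
  have hmul : Submodule.span k (S * T) = Submodule.span k S * Submodule.span k T :=
    (Submodule.span_mul_span k S T).symm
  have hadj : Algebra.adjoin k (Submodule.span k S : Set A) = Algebra.adjoin k S :=
    Algebra.adjoin_span k
  have hcomm' : ∀ a ∈ Submodule.span k S, ∀ b ∈ Submodule.span k S, a * b = b * a := by
    intro a ha b hb
    have hsub := Algebra.span_le_adjoin k S
    exact Algebra.commute_of_mem_adjoin_of_forall_mem_commute (hsub hb) fun c hc =>
      (Algebra.commute_of_mem_adjoin_of_forall_mem_commute (hsub ha) fun d hd =>
        hcomm c hc d hd).symm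
  have hfin' : (Set.Iic (Algebra.adjoin k (Submodule.span k S : Set A))).Finite := by
    rw [hadj]
    refine (Set.finite_range fun K : Subalgebra k (Algebra.adjoin k S) =>
      K.map (Algebra.adjoin k S).val).subset fun K hK => ⟨K.comap (Algebra.adjoin k S).val, ?_⟩
    ext x
    simp only [Subalgebra.mem_map, Subalgebra.mem_comap]
    exact ⟨by rintro ⟨y, hy, rfl⟩; exact hy, fun hx => ⟨⟨x, hK hx⟩, hx, rfl⟩⟩
  obtain ⟨s, hs⟩ := hSne
  have : Nontrivial A := nontrivial_of_ne s 0 fun h => hS0 (h ▸ hs)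
  obtain ⟨K, hK, hle⟩ := exists_subalgebra_finrank_add_le _ _ hSu hTu hcomm' hfin'
  rw [← hmul] at hK hle
  have hKH : Module.finrank k K ≤ Module.finrank k H :=
    Submodule.finrank_mono (s := Subalgebra.toSubmodule K) (t := Subalgebra.toSubmodule H)
      fun h hh => (hH h).2 (hK h hh)
  have hmain := hle.trans (Nat.add_le_add_left hKH _)
  refine ⟨hmain, ?_⟩
  rintro rfl
  rwa [Subalgebra.finrank_bot] at hmain
end

section
/- Let k be an infinite field, 𝒜 a finite-dimensional unital associative k-algebra, V a finite-dimensional k-subspace of 𝒜 containing an invertible element, and λ a real number with 0 < λ ≤ 1. Then there exists a unital subalgebra ℋ_λ of 𝒜 containing the left stabilizer ℋ_l(V) = {h ∈ 𝒜 : hV ⊆ V}, such that for every finite-dimensional k-subspace W of 𝒜 containing an invertible element, dim_k k⟨W·V⟩ ≥ λ·dim_k W + dim_k V − λ·dim_k ℋ_λ (an inequality of real numbers). -/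
open Module

/-- The linear analogue of the set function `S ↦ |S V| - l |S|`. -/
noncomputable def linearConnectivity {k A : Type*} [Field k] [Ring A] [Algebra k A]
    (V : Submodule k A) (l : ℝ) (W : Submodule k A) : ℝ :=
  (finrank k (W * V : Submodule k A) : ℝ) - l * (finrank k W : ℝ)

section LinearConnectivity

variable {k A : Type*} [Field k] [Ring A] [Algebra k A]

/-- Left multiplication by a unit preserves the dimension of a subspace. -/
theorem finrank_map_mulLeft_unit (u : Aˣ) (W : Submodule k A) :
    finrank k (W.map (LinearMap.mulLeft k (u : A))) = finrank k W :=
  (Submodule.equivMapOfInjective _ (fun a b hab => by simpa using hab) W).finrank_eq.symm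

theorem map_mulLeft_mul (a : A) (W V : Submodule k A) :
    W.map (LinearMap.mulLeft k a) * V = (W * V).map (LinearMap.mulLeft k a) := by
  have h (U : Submodule k A) : U.map (LinearMap.mulLeft k a) = Submodule.span k {a} * U := by
    ext x
    simp [Submodule.mem_span_singleton_mul]
  rw [h, h, mul_assoc]

theorem linearConnectivity_map_mulLeft_unit (V : Submodule k A) (l : ℝ) (u : Aˣ)
    (W : Submodule k A) :
    linearConnectivity V l (W.map (LinearMap.mulLeft k (u : A))) = linearConnectivity V l W := by
  rw [linearConnectivity, map_mulLeft_mul, finrank_map_mulLeft_unit, finrank_map_mulLeft_unit,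
    linearConnectivity]

variable [FiniteDimensional k A]

theorem linearConnectivity_sup_add_inf_le (V : Submodule k A) (l : ℝ) (W₁ W₂ : Submodule k A) :
    linearConnectivity V l (W₁ ⊔ W₂) + linearConnectivity V l (W₁ ⊓ W₂) ≤
      linearConnectivity V l W₁ + linearConnectivity V l W₂ := by
  have hW := Submodule.finrank_sup_add_finrank_inf_eq W₁ W₂
  have hWV := Submodule.finrank_sup_add_finrank_inf_eq (W₁ * V) (W₂ * V)
  have hinf : finrank k ((W₁ ⊓ W₂) * V : Submodule k A) ≤
      finrank k ((W₁ * V) ⊓ (W₂ * V) : Submodule k A) :=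
    Submodule.finrank_mono <| le_inf (mul_le_mul' inf_le_left le_rfl)
      (mul_le_mul' inf_le_right le_rfl)
  have hW' := congrArg (fun n : ℕ => l * (n : ℝ)) hW
  rw [← Submodule.sup_mul] at hWV
  simp only [linearConnectivity]
  rify at hWV hinf
  push_cast at hW'
  linarith

/-- There is a subspace meeting the units that minimizes the linear connectivity and, among all
such minimizers, has the least dimension; moreover it may be chosen to contain `1`. -/
theorem exists_linearConnectivity_atom (V : Submodule k A) (l : ℝ) :
    ∃ H : Submodule k A, 1 ∈ H ∧ ∀ W : Submodule k A, (∃ w ∈ W, IsUnit w) →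
      linearConnectivity V l H < linearConnectivity V l W ∨
        linearConnectivity V l H = linearConnectivity V l W ∧ finrank k H ≤ finrank k W := by
  let f : Submodule k A → ℕ × ℕ := fun W => (finrank k (W * V : Submodule k A), finrank k W)
  let S : Set (Submodule k A) := {W | ∃ w ∈ W, IsUnit w}
  have hfin : (f '' S).Finite := by
    refine ((Set.finite_Iic (finrank k A)).prod (Set.finite_Iic (finrank k A))).subset ?_
    rintro _ ⟨W, -, rfl⟩
    exact ⟨Submodule.finrank_le _, Submodule.finrank_le _⟩
  have hne : (f '' S).Nonempty := ⟨f ⊤, ⊤, ⟨1, trivial, isUnit_one⟩, rfl⟩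
  obtain ⟨_, ⟨X, ⟨_, hX, u, rfl⟩, rfl⟩, hmin⟩ := Set.exists_min_image (f '' S)
    (fun p => toLex ((p.1 : ℝ) - l * (p.2 : ℝ), p.2)) hfin hne
  refine ⟨X.map (LinearMap.mulLeft k ((u⁻¹ : Aˣ) : A)), ⟨u, hX, by simp⟩, fun W hW => ?_⟩
  rw [linearConnectivity_map_mulLeft_unit, finrank_map_mulLeft_unit]
  exact Prod.Lex.toLex_le_toLex.mp (hmin (f W) ⟨W, hW, rfl⟩)

theorem finite_spectrum_of_finiteDimensional (k : Type*) {A : Type*} [Field k] [Ring A]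
    [Algebra k A] [FiniteDimensional k A] (a : A) : (spectrum k a).Finite := by
  have ha : IsIntegral k a := Algebra.IsIntegral.isIntegral a
  refine (minpoly k a).rootSet_finite k |>.subset fun r hr => ?_
  rw [Polynomial.mem_rootSet_of_ne (minpoly.ne_zero ha), Polynomial.coe_aeval_eq_eval]
  have hmem := spectrum.subset_polynomial_aeval a (minpoly k a) ⟨r, hr, rfl⟩
  rw [minpoly.aeval, spectrum.mem_iff, sub_zero] at hmem
  by_contra hne
  exact hmem ((Ne.isUnit hne).map (algebraMap k A))

/-- A subspace containing `1` and stable under left multiplication by its units is stable under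
multiplication. -/
theorem mul_mem_of_units_mul_mem [Infinite k] {H : Submodule k A} (h1 : 1 ∈ H)
    (hu : ∀ u : Aˣ, (u : A) ∈ H → ∀ x ∈ H, (u : A) * x ∈ H) {a b : A} (ha : a ∈ H) (hb : b ∈ H) :
    a * b ∈ H := by
  obtain ⟨r, hr⟩ := (finite_spectrum_of_finiteDimensional k a).exists_notMem
  obtain ⟨u, hur⟩ := spectrum.notMem_iff.mp hr
  have hr1 : algebraMap k A r ∈ H := by
    rw [Algebra.algebraMap_eq_smul_one]; exact H.smul_mem r h1
  have hmem := hu u (hur ▸ H.sub_mem hr1 ha) b hb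
  rw [hur, sub_mul, ← Algebra.smul_def] at hmem
  simpa using H.sub_mem (H.smul_mem r hb) hmem

end LinearConnectivity

theorem stmt_16 {k A : Type*} [Field k] [Infinite k] [Ring A] [Algebra k A]
    [FiniteDimensional k A]
    (V : Submodule k A) (hV : ∃ v ∈ V, IsUnit v)
    (l : ℝ) (hl0 : 0 < l) (hl1 : l ≤ 1) :
    ∃ H : Subalgebra k A,
      (∀ h : A, (∀ v ∈ V, h * v ∈ V) → h ∈ H) ∧
      ∀ W : Submodule k A, (∃ w ∈ W, IsUnit w) →
        l * (Module.finrank k W : ℝ) + (Module.finrank k V : ℝ) -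
            l * (Module.finrank k H : ℝ) ≤
          (Module.finrank k (W * V : Submodule k A) : ℝ) := by
  obtain ⟨H, h1, hH⟩ := exists_linearConnectivity_atom V l
  have hmin (W : Submodule k A) (hW : ∃ w ∈ W, IsUnit w) :
      linearConnectivity V l H ≤ linearConnectivity V l W :=
    (hH W hW).elim le_of_lt fun h => h.1.le
  have hmul (u : Aˣ) (hu : (u : A) ∈ H) (x : A) (hx : x ∈ H) : (u : A) * x ∈ H := by
    let K := H.map (LinearMap.mulLeft k (u : A))
    have huK : (u : A) ∈ K := ⟨1, h1, by simp⟩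
    have hsub := linearConnectivity_sup_add_inf_le V l H K
    have hK : linearConnectivity V l K = linearConnectivity V l H :=
      linearConnectivity_map_mulLeft_unit V l u H
    have hsup := hmin (H ⊔ K) ⟨1, Submodule.mem_sup_left h1, isUnit_one⟩
    have hdim : finrank k H ≤ finrank k (H ⊓ K : Submodule k A) := by
      rcases hH (H ⊓ K) ⟨u, ⟨hu, huK⟩, u.isUnit⟩ with h | h
      · linarith
      · exact h.2
    have hHK : H ⊓ K = K := Submodule.eq_of_le_of_finrank_le inf_le_right <| by
      rwa [finrank_map_mulLeft_unit]
    exact inf_eq_right.mp hHK ⟨x, hx, rfl⟩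
  let B : Subalgebra k A := H.toSubalgebra h1 fun a b ha hb => mul_mem_of_units_mul_mem h1 hmul ha hb
  refine ⟨B, fun h hh => ?_, fun W hW => ?_⟩
  · let S : Submodule k A := Submodule.span k {1, h}
    have hSV : S * V ≤ V := by
      rw [Submodule.mul_le]
      intro s hs v hv
      obtain ⟨a, b, rfl⟩ := Submodule.mem_span_pair.mp hs
      simpa [add_mul] using V.add_mem (V.smul_mem a hv) (V.smul_mem b (hh v hv))
    have h1S : (1 : A) ∈ S := Submodule.subset_span (by simp)
    have hHS : H ≤ H * S := fun x hx => by simpa using Submodule.mul_mem_mul hx h1S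
    have hle : finrank k (H * S * V : Submodule k A) ≤ finrank k (H * V : Submodule k A) := by
      rw [mul_assoc]
      exact Submodule.finrank_mono (mul_le_mul' le_rfl hSV)
    have hc := hmin (H * S) ⟨1, hHS h1, isUnit_one⟩
    have hdim : finrank k (H * S : Submodule k A) ≤ finrank k H := by
      simp only [linearConnectivity] at hc
      rify at hle ⊢
      exact le_of_mul_le_mul_left (by linarith) hl0
    have hHeq := Submodule.eq_of_le_of_finrank_le hHS hdim
    have hmem : 1 * h ∈ H * S := Submodule.mul_mem_mul h1 (Submodule.subset_span (by simp))
    rw [← hHeq, one_mul] at hmem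
    exact hmem
  · have hc := hmin W hW
    have hVle : finrank k V ≤ finrank k (H * V : Submodule k A) :=
      Submodule.finrank_mono fun v hv => by simpa using Submodule.mul_mem_mul h1 hv
    have hB : finrank k B = finrank k H := rfl
    rw [hB]
    simp only [linearConnectivity] at hc
    rify at hVle
    linarith
end

section
/- Let k be an infinite field, 𝒜 a finite-dimensional unital associative k-algebra, and ε a real number with 0 < ε < 2. Let V and W be finite-dimensional k-subspaces of 𝒜, each containing an invertible element of 𝒜, such that dim_k W ≥ dim_k V and dim_k k⟨W·V⟩ ≤ (2−ε)·dim_k V. Then there exists a unital subalgebra ℋ of 𝒜 such that dim_k ℋ ≤ (2/ε − 1)·dim_k V, V is contained in the left ℋ-module k⟨ℋ·V⟩, and dim_k k⟨ℋ·V⟩ ≤ (2/ε − 1)·dim_k ℋ. -/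
open Module

/-- Left multiplication by a subspace containing a unit does not decrease dimensions. -/
theorem Submodule.finrank_le_finrank_mul_of_isUnit_left {k A : Type*} [Field k] [Ring A]
    [Algebra k A] [FiniteDimensional k A] (X Y : Submodule k A) (hX : ∃ x ∈ X, IsUnit x) :
    finrank k Y ≤ finrank k (X * Y : Submodule k A) := by
  obtain ⟨x, hx, hu⟩ := hX
  have hinj : Function.Injective (LinearMap.mulLeft k x) := fun a b h => hu.mul_left_cancel h
  rw [(Submodule.equivMapOfInjective _ hinj Y).finrank_eq]
  refine Submodule.finrank_mono ?_
  rintro _ ⟨y, hy, rfl⟩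
  exact Submodule.mul_mem_mul hx hy

/-- Right multiplication by a subspace containing a unit does not decrease dimensions. -/
theorem Submodule.finrank_le_finrank_mul_of_isUnit_right {k A : Type*} [Field k] [Ring A]
    [Algebra k A] [FiniteDimensional k A] (X Y : Submodule k A) (hY : ∃ y ∈ Y, IsUnit y) :
    finrank k X ≤ finrank k (X * Y : Submodule k A) := by
  obtain ⟨y, hy, hu⟩ := hY
  have hinj : Function.Injective (LinearMap.mulRight k y) := fun a b h => hu.mul_right_cancel h
  rw [(Submodule.equivMapOfInjective _ hinj X).finrank_eq]
  refine Submodule.finrank_mono ?_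
  rintro _ ⟨x, hx, rfl⟩
  exact Submodule.mul_mem_mul hx hy

/-- Left multiplication by a unit preserves dimensions. -/
theorem Submodule.finrank_span_unit_mul {k A : Type*} [Field k] [Ring A]
    [Algebra k A] [FiniteDimensional k A] (u : Aˣ) (X : Submodule k A) :
    finrank k (Submodule.span k {(u : A)} * X : Submodule k A) = finrank k X := by
  have key (v : Aˣ) (Y : Submodule k A) := Submodule.finrank_le_finrank_mul_of_isUnit_left
    (Submodule.span k {(v : A)}) Y ⟨v, Submodule.mem_span_singleton_self _, v.isUnit⟩
  refine le_antisymm ?_ (key u X)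
  have h := key u⁻¹ (Submodule.span k {(u : A)} * X)
  rwa [← mul_assoc, Submodule.span_mul_span, Set.singleton_mul_singleton, Units.inv_mul,
    ← Submodule.one_eq_span, one_mul] at h

/-- Over an infinite field, every element of a finite-dimensional algebra becomes a unit after
adding a suitable scalar. -/
theorem exists_isUnit_algebraMap_add {k A : Type*} [Field k] [Infinite k] [Ring A] [Algebra k A]
    [FiniteDimensional k A] (x : A) : ∃ t : k, IsUnit (algebraMap k A t + x) := by
  have hfin : (spectrum k (-x)).Finite := by
    refine (Module.End.finite_spectrum (Algebra.lmul k A (-x))).subset ?_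
    intro t ht
    contrapose! ht
    rw [spectrum.notMem_iff] at ht ⊢
    rw [← AlgHom.commutes (Algebra.lmul k A), ← map_sub] at ht
    obtain ⟨hinj, hsurj⟩ := (Module.End.isUnit_iff _).1 ht
    obtain ⟨y, hy⟩ := hsurj 1
    replace hy : (algebraMap k A t - -x) * y = 1 := hy
    refine isUnit_iff_exists.2 ⟨y, hy, hinj ?_⟩
    change (algebraMap k A t - -x) * (y * _) = (algebraMap k A t - -x) * 1
    rw [← mul_assoc, hy, one_mul, mul_one]
  obtain ⟨t, ht⟩ := hfin.exists_notMem
  exact ⟨t, by simpa [spectrum.notMem_iff] using ht⟩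

/-- The connectivity functional `X ↦ dim (X * V) - K * dim X`. -/
noncomputable def Submodule.connectivity {k A : Type*} [Field k] [Ring A] [Algebra k A]
    (K : ℝ) (V X : Submodule k A) : ℝ :=
  finrank k (X * V : Submodule k A) - K * finrank k X

theorem Submodule.connectivity_sup_add_connectivity_inf_le {k A : Type*} [Field k] [Ring A]
    [Algebra k A] [FiniteDimensional k A] (K : ℝ) (V X Y : Submodule k A) :
    connectivity K V (X ⊔ Y) + connectivity K V (X ⊓ Y) ≤
      connectivity K V X + connectivity K V Y := by
  have h₁ : (finrank k ↥(X ⊔ Y) : ℝ) + finrank k ↥(X ⊓ Y) = finrank k X + finrank k Y := by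
    exact_mod_cast Submodule.finrank_sup_add_finrank_inf_eq X Y
  have h₂ : (finrank k ↥(X * V ⊔ Y * V) : ℝ) + finrank k ↥(X * V ⊓ Y * V) =
      finrank k ↥(X * V) + finrank k ↥(Y * V) := by
    exact_mod_cast Submodule.finrank_sup_add_finrank_inf_eq (X * V) (Y * V)
  have h₃ : (finrank k ↥((X ⊓ Y) * V) : ℝ) ≤ finrank k ↥(X * V ⊓ Y * V) := by
    exact_mod_cast Submodule.finrank_mono
      (le_inf (mul_le_mul_left inf_le_left V) (mul_le_mul_left inf_le_right V))
  unfold connectivity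
  rw [Submodule.sup_mul]
  linear_combination h₂ + h₃ - K * h₁

theorem Submodule.connectivity_span_unit_mul {k A : Type*} [Field k] [Ring A]
    [Algebra k A] [FiniteDimensional k A] (K : ℝ) (V : Submodule k A) (u : Aˣ)
    (X : Submodule k A) :
    connectivity K V (Submodule.span k {(u : A)} * X) = connectivity K V X := by
  unfold connectivity
  rw [mul_assoc, finrank_span_unit_mul, finrank_span_unit_mul]

/-- Among the subspaces containing a unit, the connectivity is minimized by a subalgebra. -/
theorem exists_subalgebra_connectivity_le {k A : Type*} [Field k] [Infinite k] [Ring A]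
    [Algebra k A] [FiniteDimensional k A] (K : ℝ) (V : Submodule k A) :
    ∃ H : Subalgebra k A, ∀ X : Submodule k A, (∃ x ∈ X, IsUnit x) →
      Submodule.connectivity K V (Subalgebra.toSubmodule H) ≤ Submodule.connectivity K V X := by
  let dims : Submodule k A → ℕ × ℕ := fun X => (finrank k ↥(X * V), finrank k X)
  have hfin : (dims '' {X | ∃ x ∈ X, IsUnit x}).Finite := by
    refine (Set.finite_Iic (finrank k A, finrank k A)).subset ?_
    rintro _ ⟨X, -, rfl⟩
    exact ⟨Submodule.finrank_le _, Submodule.finrank_le _⟩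
  obtain ⟨_, ⟨X₀, ⟨x, hx, u, rfl⟩, rfl⟩, hmin⟩ := Set.exists_min_image _
    (fun p : ℕ × ℕ => toLex ((p.1 : ℝ) - K * p.2, p.2)) hfin ⟨_, ⊤, ⟨1, trivial, isUnit_one⟩, rfl⟩
  have hc (X : Submodule k A) (hX : ∃ x ∈ X, IsUnit x) :
      Submodule.connectivity K V X₀ < Submodule.connectivity K V X ∨
        Submodule.connectivity K V X₀ = Submodule.connectivity K V X ∧
          finrank k X₀ ≤ finrank k X :=
    Prod.Lex.toLex_le_toLex.1 (hmin _ ⟨X, hX, rfl⟩)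
  have hle (X : Submodule k A) (hX : ∃ x ∈ X, IsUnit x) :
      Submodule.connectivity K V X₀ ≤ Submodule.connectivity K V X := by
    rcases hc X hX with h | h
    exacts [h.le, h.1.le]
  set H₀ : Submodule k A := Submodule.span k {((u⁻¹ : Aˣ) : A)} * X₀ with hH₀
  have hcH : Submodule.connectivity K V H₀ = Submodule.connectivity K V X₀ :=
    Submodule.connectivity_span_unit_mul K V u⁻¹ X₀
  have hdH : finrank k H₀ = finrank k X₀ := Submodule.finrank_span_unit_mul u⁻¹ X₀
  have hone : (1 : A) ∈ H₀ := by
    simpa using Submodule.mul_mem_mul (Submodule.mem_span_singleton_self ((u⁻¹ : Aˣ) : A)) hx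
  -- A translate of `H₀` which meets it in a unit coincides with it.
  have hunit (v : Aˣ) (hv : (v : A) ∈ H₀) : Submodule.span k {(v : A)} * H₀ = H₀ := by
    set Y : Submodule k A := Submodule.span k {(v : A)} * H₀
    have hvY : (v : A) ∈ Y := by
      simpa using Submodule.mul_mem_mul (Submodule.mem_span_singleton_self (v : A)) hone
    have hcY : Submodule.connectivity K V Y = Submodule.connectivity K V X₀ :=
      (Submodule.connectivity_span_unit_mul K V v H₀).trans hcH
    have hdY : finrank k Y = finrank k X₀ := (Submodule.finrank_span_unit_mul v H₀).trans hdH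
    have hsub := Submodule.connectivity_sup_add_connectivity_inf_le K V Y H₀
    have hsup := hle (Y ⊔ H₀) ⟨v, Submodule.mem_sup_left hvY, v.isUnit⟩
    have hdim : finrank k X₀ ≤ finrank k ↥(Y ⊓ H₀) := by
      rcases hc (Y ⊓ H₀) ⟨v, ⟨hvY, hv⟩, v.isUnit⟩ with h | h
      · linarith
      · exact h.2
    have h₁ := Submodule.eq_of_le_of_finrank_le (inf_le_left : Y ⊓ H₀ ≤ Y) (hdY.trans_le hdim)
    have h₂ := Submodule.eq_of_le_of_finrank_le (inf_le_right : Y ⊓ H₀ ≤ H₀) (hdH.trans_le hdim)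
    exact h₁.symm.trans h₂
  have hmul (x y : A) (hx : x ∈ H₀) (hy : y ∈ H₀) : x * y ∈ H₀ := by
    obtain ⟨t, v, hv⟩ := exists_isUnit_algebraMap_add (k := k) x
    have ht : (algebraMap k A t) ∈ H₀ := by
      rw [Algebra.algebraMap_eq_smul_one]
      exact H₀.smul_mem t hone
    have hvy : (v : A) * y ∈ H₀ := by
      rw [← hunit v (hv ▸ H₀.add_mem ht hx)]
      exact Submodule.mul_mem_mul (Submodule.mem_span_singleton_self _) hy
    have hxy : x * y = v * y - t • y := by
      rw [hv, add_mul, Algebra.smul_def, add_sub_cancel_left]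
    exact hxy ▸ H₀.sub_mem hvy (H₀.smul_mem t hy)
  refine ⟨H₀.toSubalgebra hone hmul, fun X hX => ?_⟩
  rw [Submodule.toSubalgebra_toSubmodule, hcH]
  exact hle X hX


theorem stmt_17 {k A : Type*} [Field k] [Infinite k] [Ring A] [Algebra k A]
    [FiniteDimensional k A]
    (ε : ℝ) (hε0 : 0 < ε) (hε2 : ε < 2)
    (V W : Submodule k A) (hVu : ∃ v ∈ V, IsUnit v) (hWu : ∃ w ∈ W, IsUnit w)
    (hdim : Module.finrank k V ≤ Module.finrank k W)
    (hsmall : (Module.finrank k (W * V : Submodule k A) : ℝ) ≤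
      (2 - ε) * (Module.finrank k V : ℝ)) :
    ∃ H : Subalgebra k A,
      (Module.finrank k H : ℝ) ≤ (2 / ε - 1) * (Module.finrank k V : ℝ) ∧
      V ≤ Subalgebra.toSubmodule H * V ∧
      (Module.finrank k (Subalgebra.toSubmodule H * V : Submodule k A) : ℝ) ≤
        (2 / ε - 1) * (Module.finrank k H : ℝ) := by
  obtain ⟨H, hH⟩ := exists_subalgebra_connectivity_le (1 - ε / 2) V
  have hmin := hH W hWu
  simp only [Submodule.connectivity, Subalgebra.finrank_toSubmodule] at hmin
  have hVW : (finrank k V : ℝ) ≤ finrank k W := by exact_mod_cast hdim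
  have hbound : (finrank k ↥(Subalgebra.toSubmodule H * V) : ℝ) ≤
      (1 - ε / 2) * finrank k H + (1 - ε / 2) * finrank k V := by
    nlinarith
  have hVle : V ≤ Subalgebra.toSubmodule H * V := fun v hv => by
    simpa using Submodule.mul_mem_mul (show (1 : A) ∈ Subalgebra.toSubmodule H from H.one_mem) hv
  have hV : (finrank k V : ℝ) ≤ finrank k ↥(Subalgebra.toSubmodule H * V) := by
    exact_mod_cast Submodule.finrank_mono hVle
  have hHV : (finrank k H : ℝ) ≤ finrank k ↥(Subalgebra.toSubmodule H * V) := by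
    exact_mod_cast Submodule.finrank_le_finrank_mul_of_isUnit_right (Subalgebra.toSubmodule H) V hVu
  have hε : 2 / ε - 1 = (1 - ε / 2) / (ε / 2) := by field_simp
  rw [hε]
  refine ⟨H, ?_, hVle, ?_⟩ <;> rw [div_mul_eq_mul_div, le_div_iff₀ (by positivity)] <;> nlinarith
end

section
/- Let G be a group, k a field, and A a finite nonempty subset of G. Let H = {h ∈ G : hA = A} be the left stabilizer of A in G. In the group algebra k[G], with canonical basis {e_g : g ∈ G}, write Ā = {e_a : a ∈ A} and H̄ = {e_h : h ∈ H}. Then the left stabilizer of the k-span of Ā in k[G], namely {x ∈ k[G] : x·k⟨Ā⟩ ⊆ k⟨Ā⟩}, is equal to the k-span of H̄; that is, it equals the group algebra k[H] viewed inside k[G]. -/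
open Pointwise

/-- The span of the basis vectors indexed by `S` consists of the elements supported in `S`. -/
theorem MonoidAlgebra.mem_span_of_image_iff {k G : Type*} [Semiring k] [MulOneClass G] {S : Set G}
    {x : MonoidAlgebra k G} :
    x ∈ Submodule.span k (MonoidAlgebra.of k G '' S) ↔ ∀ g, x.coeff g ≠ 0 → g ∈ S := by
  refine ⟨fun hx g => ?_, fun h => ?_⟩
  · induction hx using Submodule.span_induction with
    | mem y hy =>
      obtain ⟨s, hs, rfl⟩ := hy
      intro hg
      have : s = g := by
        by_contra hne
        exact hg (by simp [MonoidAlgebra.of, hne])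
      exact this ▸ hs
    | zero => simp
    | add y z _ _ hy hz =>
      intro hg
      by_cases hy0 : y.coeff g = 0
      · exact hz fun hz0 => hg (by simp [hy0, hz0])
      · exact hy hy0
    | smul c y _ hy =>
      exact fun hg => hy fun hy0 => hg (by simp [hy0])
  · refine Submodule.span_mono (Set.image_mono fun g hg => h g ?_)
      (MonoidAlgebra.mem_span_support_coeff x)
    simpa using hg

theorem stmt_18 {G : Type*} [Group G] (k : Type*) [Field k]
    (A : Set G) (hA : A.Finite) (hAne : A.Nonempty) :
    {x : MonoidAlgebra k G |
        ∀ v ∈ Submodule.span k (MonoidAlgebra.of k G '' A),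
          x * v ∈ Submodule.span k (MonoidAlgebra.of k G '' A)} =
      ↑(Submodule.span k (MonoidAlgebra.of k G '' {h : G | h • A = A})) := by
  ext x
  simp only [Set.mem_ofPred_eq, SetLike.mem_coe]
  constructor
  · refine fun hx => MonoidAlgebra.mem_span_of_image_iff.2 fun g hg => ?_
    refine (MulAction.mem_stabilizer_set_iff_smul_set_subset hA).2 ?_
    rintro _ ⟨a, ha, rfl⟩
    refine MonoidAlgebra.mem_span_of_image_iff.1
      (hx _ (Submodule.subset_span (Set.mem_image_of_mem _ ha))) _ ?_
    simpa [MonoidAlgebra.of] using hg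
  · intro hx v hv
    have hmul := Submodule.mul_mem_mul hx hv
    rw [Submodule.span_mul_span] at hmul
    refine Submodule.span_mono ?_ hmul
    rintro _ ⟨_, ⟨h, hh, rfl⟩, _, ⟨a, ha, rfl⟩, rfl⟩
    refine ⟨h * a, ?_, map_mul _ _ _⟩
    rw [← show h • A = A from hh]
    exact Set.smul_mem_smul_set ha
end

section
/- (Diderrich's theorem) Let G be a group and let A and B be finite nonempty subsets of G such that the elements of A pairwise commute. Let H = {g ∈ G : g·(AB) = AB} be the left stabilizer of the product set AB = {ab : a ∈ A, b ∈ B}; H is a finite subgroup of G. Then |AB| ≥ |A| + |B| − |H|. -/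
open Pointwise

/-- The multiplication map sends `{h ∈ H₂ | h y ∈ C₁} × {h ∈ H₁ | h y ∉ C₂}` into `C₁ \ C₂`,
with fibres of size at most `|H₁ ∩ H₂|`. -/
theorem card_filter_mul_card_filter_le {G : Type*} [Group G] [DecidableEq G]
    (H₁ H₂ C₁ C₂ : Finset G) (L₁ L₂ : Subgroup G) (hL₁ : ∀ g, g ∈ H₁ ↔ g ∈ L₁)
    (hL₂ : ∀ g, g ∈ H₂ ↔ g ∈ L₂) (hcomm : ∀ g ∈ H₁, ∀ h ∈ H₂, g * h = h * g)
    (hC₁ : ∀ h ∈ H₁, ∀ c ∈ C₁, h * c ∈ C₁) (hC₂ : ∀ h ∈ H₂, ∀ c ∈ C₂, h * c ∈ C₂) (y : G) :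
    (H₂.filter (fun h => h * y ∈ C₁)).card * (H₁.filter (fun h => h * y ∉ C₂)).card ≤
      (H₁ ∩ H₂).card * (C₁ \ C₂).card := by
  rw [← Finset.card_product]
  refine Finset.card_le_mul_card_image_of_maps_to (f := fun p : G × G => p.2 * p.1 * y)
    ?_ _ ?_
  · rintro ⟨h, g⟩ hp
    simp only [Finset.mem_product, Finset.mem_filter] at hp
    obtain ⟨⟨hh, hhy⟩, hg, hgy⟩ := hp
    simp only [Finset.mem_sdiff]
    refine ⟨by rw [mul_assoc]; exact hC₁ g hg _ hhy, fun hc => hgy ?_⟩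
    have := hC₂ h⁻¹ ((hL₂ _).2 (L₂.inv_mem ((hL₂ _).1 hh))) _ hc
    rwa [hcomm g hg h hh, mul_assoc, inv_mul_cancel_left] at this
  · intro z _
    obtain hE | ⟨⟨k, l⟩, hkl⟩ := Finset.eq_empty_or_nonempty
      (((H₂.filter (fun h => h * y ∈ C₁)) ×ˢ (H₁.filter (fun h => h * y ∉ C₂))).filter
        (fun p : G × G => p.2 * p.1 * y = z))
    · rw [hE]; simp
    · simp only [Finset.mem_product, Finset.mem_filter] at hkl
      obtain ⟨⟨⟨hk, -⟩, hl, -⟩, hz⟩ := hkl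
      refine Finset.card_le_card_of_injOn (fun p => l⁻¹ * p.2) ?_ ?_
      · rintro ⟨h, g⟩ hp
        simp only [Finset.coe_filter, Finset.mem_product, Finset.mem_filter,
          Set.mem_ofPred_eq] at hp
        obtain ⟨⟨⟨hh, -⟩, hg, -⟩, hz'⟩ := hp
        have e : g * h = l * k := mul_right_cancel (hz'.trans hz.symm)
        have e' : l⁻¹ * g = k * h⁻¹ := by
          rw [inv_mul_eq_iff_eq_mul, ← mul_assoc, ← e, mul_inv_cancel_right]
        simp only [Finset.coe_inter, Set.mem_inter_iff, Finset.mem_coe]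
        refine ⟨(hL₁ _).2 (L₁.mul_mem (L₁.inv_mem ((hL₁ _).1 hl)) ((hL₁ _).1 hg)), ?_⟩
        rw [e']
        exact (hL₂ _).2 (L₂.mul_mem ((hL₂ _).1 hk) (L₂.inv_mem ((hL₂ _).1 hh)))
      · rintro ⟨h, g⟩ hp ⟨h', g'⟩ hp' hgg
        simp only [Finset.coe_filter, Set.mem_ofPred_eq] at hp hp'
        have hg : g = g' := mul_left_cancel hgg
        subst hg
        have : h = h' := mul_left_cancel (mul_right_cancel (hp.2.trans hp'.2.symm))
        rw [this]

/-- The union inequality behind Kneser's theorem, when `|H₂| ≤ |H₁|`. -/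
theorem card_le_card_sdiff_add_card_inter_of_card_le {G : Type*} [Group G] [DecidableEq G]
    (H₁ H₂ C₁ C₂ : Finset G) (L₁ L₂ : Subgroup G) (hL₁ : ∀ g, g ∈ H₁ ↔ g ∈ L₁)
    (hL₂ : ∀ g, g ∈ H₂ ↔ g ∈ L₂) (hcomm : ∀ g ∈ H₁, ∀ h ∈ H₂, g * h = h * g)
    (hC₁ : ∀ h ∈ H₁, ∀ c ∈ C₁, h * c ∈ C₁) (hC₂ : ∀ h ∈ H₂, ∀ c ∈ C₂, h * c ∈ C₂)
    (hle : H₂.card ≤ H₁.card) (hne : ¬ C₁ ⊆ C₂) :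
    H₁.card ≤ (C₂ \ C₁).card + (H₁ ∩ H₂).card ∨
      H₂.card ≤ (C₁ \ C₂).card + (H₁ ∩ H₂).card := by
  by_contra! hcon
  obtain ⟨hlt₁, hlt₂⟩ := hcon
  obtain ⟨y, hy₁, hy₂⟩ := Finset.not_subset.1 hne
  have one₁ : (1 : G) ∈ H₁ := (hL₁ _).2 L₁.one_mem
  have one₂ : (1 : G) ∈ H₂ := (hL₂ _).2 L₂.one_mem
  have hC₁' : ∀ h ∈ H₁, ∀ c, h * c ∈ C₁ → c ∈ C₁ := fun h hh c hc => by
    simpa using hC₁ h⁻¹ ((hL₁ _).2 (L₁.inv_mem ((hL₁ _).1 hh))) _ hc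
  have hC₂' : ∀ h ∈ H₂, ∀ c, h * c ∈ C₂ → c ∈ C₂ := fun h hh c hc => by
    simpa using hC₂ h⁻¹ ((hL₂ _).2 (L₂.inv_mem ((hL₂ _).1 hh))) _ hc
  have hPR := card_filter_mul_card_filter_le H₁ H₂ C₁ C₂ L₁ L₂ hL₁ hL₂ hcomm hC₁ hC₂ y
  have hQS := card_filter_mul_card_filter_le H₂ H₁ C₂ C₁ L₂ L₁ hL₂ hL₁
    (fun g hg h hh => (hcomm h hh g hg).symm) hC₂ hC₁ y
  rw [Finset.inter_comm H₂ H₁] at hQS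
  have hPS := Finset.card_filter_add_card_filter_not (s := H₂) (fun h => h * y ∈ C₁)
  have hQR := Finset.card_filter_add_card_filter_not (s := H₁) (fun h => h * y ∈ C₂)
  -- a nonempty union of cosets of the intersection has at least as many elements
  have hP : (H₁ ∩ H₂).card ≤ (H₂.filter (fun h => h * y ∈ C₁)).card := by
    refine Finset.card_le_card fun g hg => ?_
    rw [Finset.mem_inter] at hg
    exact Finset.mem_filter.2 ⟨hg.2, hC₁ g hg.1 y hy₁⟩
  have hQ : (H₁ ∩ H₂).card ≤ (H₁.filter (fun h => h * y ∈ C₂)).card := by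
    have : ∃ h ∈ H₁, h * y ∈ C₂ := by
      by_contra! hno
      have : H₁.card ≤ (C₁ \ C₂).card := by
        refine Finset.card_le_card_of_injOn (fun h => h * y) ?_ ?_
        · intro h hh
          exact Finset.mem_coe.2 (Finset.mem_sdiff.2 ⟨hC₁ h hh y hy₁, hno h hh⟩)
        · exact fun _ _ _ _ h => mul_right_cancel h
      omega
    obtain ⟨k, hk, hky⟩ := this
    refine Finset.card_le_card_of_injOn (fun g => g * k) ?_ ?_
    · intro g hg
      obtain ⟨hg₁, hg₂⟩ := Finset.mem_inter.1 (Finset.mem_coe.1 hg)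
      refine Finset.mem_coe.2 (Finset.mem_filter.2
        ⟨(hL₁ _).2 (L₁.mul_mem ((hL₁ _).1 hg₁) ((hL₁ _).1 hk)), ?_⟩)
      rw [mul_assoc]
      exact hC₂ g hg₂ _ hky
    · exact fun _ _ _ _ h => mul_right_cancel h
  have hR : (H₁ ∩ H₂).card ≤ (H₁.filter (fun h => h * y ∉ C₂)).card := by
    refine Finset.card_le_card fun g hg => ?_
    rw [Finset.mem_inter] at hg
    exact Finset.mem_filter.2 ⟨hg.1, fun h => hy₂ (hC₂' g hg.2 y h)⟩
  have hS : (H₁ ∩ H₂).card ≤ (H₂.filter (fun h => h * y ∉ C₁)).card := by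
    have : ∃ h ∈ H₂, h * y ∉ C₁ := by
      by_contra! hno
      have : H₂.card ≤ (C₁ \ C₂).card := by
        refine Finset.card_le_card_of_injOn (fun h => h * y) ?_ ?_
        · intro h hh
          exact Finset.mem_coe.2 (Finset.mem_sdiff.2
            ⟨hno h hh, fun hc => hy₂ (hC₂' h hh y hc)⟩)
        · exact fun _ _ _ _ h => mul_right_cancel h
      omega
    obtain ⟨k, hk, hky⟩ := this
    refine Finset.card_le_card_of_injOn (fun g => g * k) ?_ ?_
    · intro g hg
      obtain ⟨hg₁, hg₂⟩ := Finset.mem_inter.1 (Finset.mem_coe.1 hg)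
      refine Finset.mem_coe.2 (Finset.mem_filter.2
        ⟨(hL₂ _).2 (L₂.mul_mem ((hL₂ _).1 hg₂) ((hL₂ _).1 hk)), fun hc => hky ?_⟩)
      rw [mul_assoc] at hc
      exact hC₁' g hg₁ _ hc
    · exact fun _ _ _ _ h => mul_right_cancel h
  generalize (H₂.filter (fun h => h * y ∈ C₁)).card = P at *
  generalize (H₁.filter (fun h => h * y ∈ C₂)).card = Q at *
  generalize (H₁.filter (fun h => h * y ∉ C₂)).card = R at *
  generalize (H₂.filter (fun h => h * y ∉ C₁)).card = S at *
  have hd : 0 < (H₁ ∩ H₂).card := Finset.card_pos.2 ⟨1, Finset.mem_inter.2 ⟨one₁, one₂⟩⟩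
  generalize (H₁ ∩ H₂).card = d at *
  obtain ⟨p, rfl⟩ := Nat.exists_eq_add_of_le hP
  obtain ⟨q, rfl⟩ := Nat.exists_eq_add_of_le hQ
  obtain ⟨r, rfl⟩ := Nat.exists_eq_add_of_le hR
  obtain ⟨s, rfl⟩ := Nat.exists_eq_add_of_le hS
  have h₁ : (C₂ \ C₁).card < d + q + r := by omega
  have h₂ : (C₁ \ C₂).card < d + p + s := by omega
  have h₃ := Nat.mul_lt_mul_of_pos_left h₁ hd
  have h₄ := Nat.mul_lt_mul_of_pos_left h₂ hd
  nlinarith [Nat.zero_le (q * s), Nat.zero_le (p * r)]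

/-- `C` is stable under left multiplication by a finite subgroup `H ≤ K` with
`n ≤ |C| + |H|`. -/
def HasLargePeriod {G : Type*} [Group G] (K : Subgroup G) (n : ℕ) (C : Finset G) : Prop :=
  ∃ (L : Subgroup G) (H : Finset G), L ≤ K ∧ (∀ g, g ∈ H ↔ g ∈ L) ∧
    (∀ h ∈ H, ∀ c ∈ C, h * c ∈ C) ∧ n ≤ C.card + H.card

theorem HasLargePeriod.union {G : Type*} [Group G] [DecidableEq G] {K : Subgroup G}
    (hK : ∀ g ∈ K, ∀ h ∈ K, g * h = h * g) {n : ℕ} {C₁ C₂ : Finset G}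
    (h₁ : HasLargePeriod K n C₁) (h₂ : HasLargePeriod K n C₂) :
    HasLargePeriod K n (C₁ ∪ C₂) := by
  by_cases h₁₂ : C₁ ⊆ C₂
  · rwa [Finset.union_eq_right.2 h₁₂]
  by_cases h₂₁ : C₂ ⊆ C₁
  · rwa [Finset.union_eq_left.2 h₂₁]
  obtain ⟨L₁, H₁, hLK₁, hL₁, hC₁, hn₁⟩ := h₁
  obtain ⟨L₂, H₂, hLK₂, hL₂, hC₂, hn₂⟩ := h₂
  have hcomm : ∀ g ∈ H₁, ∀ h ∈ H₂, g * h = h * g := fun g hg h hh =>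
    hK g (hLK₁ ((hL₁ g).1 hg)) h (hLK₂ ((hL₂ h).1 hh))
  refine ⟨L₁ ⊓ L₂, H₁ ∩ H₂, inf_le_left.trans hLK₁, fun g => ?_, fun h hh c hc => ?_, ?_⟩
  · rw [Finset.mem_inter, Subgroup.mem_inf, hL₁, hL₂]
  · rw [Finset.mem_inter] at hh
    rw [Finset.mem_union] at hc ⊢
    exact hc.imp (hC₁ h hh.1 c) (hC₂ h hh.2 c)
  have key : H₁.card ≤ (C₂ \ C₁).card + (H₁ ∩ H₂).card ∨
      H₂.card ≤ (C₁ \ C₂).card + (H₁ ∩ H₂).card := by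
    rcases le_total H₂.card H₁.card with hle | hle
    · exact card_le_card_sdiff_add_card_inter_of_card_le H₁ H₂ C₁ C₂ L₁ L₂ hL₁ hL₂ hcomm
        hC₁ hC₂ hle h₁₂
    · have := card_le_card_sdiff_add_card_inter_of_card_le H₂ H₁ C₂ C₁ L₂ L₁ hL₂ hL₁
        (fun g hg h hh => (hcomm h hh g hg).symm) hC₂ hC₁ hle h₂₁
      rw [Finset.inter_comm H₂ H₁] at this
      exact this.symm
  have e₁ := Finset.card_union_add_card_inter C₁ C₂
  have e₂ := Finset.card_sdiff_add_card_inter C₁ C₂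
  have e₃ := Finset.card_sdiff_add_card_inter C₂ C₁
  rw [Finset.inter_comm C₂ C₁] at e₃
  omega

/-- Repeated Dyson transforms produce a subset of `A * B` through a given point of `B` which
has a large period. -/
theorem exists_hasLargePeriod_of_one_mem {G : Type*} [Group G] [DecidableEq G]
    {K : Subgroup G} (hK : ∀ g ∈ K, ∀ h ∈ K, g * h = h * g) (b : G) (A : Finset G) :
    ∀ B : Finset G, (∀ a ∈ A, a ∈ K) → 1 ∈ A → b ∈ B →
      ∃ C, b ∈ C ∧ C ⊆ A * B ∧ HasLargePeriod K (A.card + B.card) C := by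
  induction A using Finset.strongInduction with
  | H A ih =>
    intro B hAK hA hb
    by_cases hstab : ∀ e ∈ B, ∀ a ∈ A, a * e ∈ B
    · have hsub : Subgroup.closure (A : Set G) ≤ MulAction.stabilizer G (B : Set G) := by
        rw [Subgroup.closure_le]
        intro a ha
        rw [SetLike.mem_coe, MulAction.mem_stabilizer_iff, ← Finset.coe_smul_finset,
          Finset.coe_inj]
        refine Finset.eq_of_subset_of_card_le (fun z hz => ?_) (by simp)
        obtain ⟨c, hc, rfl⟩ := Finset.mem_smul_finset.1 hz
        exact hstab c hc a ha
      have hmul : ∀ g ∈ Subgroup.closure (A : Set G), ∀ c ∈ B, g * c ∈ B := by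
        intro g hg c hc
        have := (MulAction.mem_stabilizer_set.1 (hsub hg) c).2 (Finset.mem_coe.2 hc)
        simpa using this
      have hfin : (Subgroup.closure (A : Set G) : Set G).Finite := by
        refine Set.Finite.of_finite_image (f := fun g => g * b)
          (B.finite_toSet.subset ?_) (fun _ _ _ _ h => mul_right_cancel h)
        rintro _ ⟨g, hg, rfl⟩
        exact hmul g hg b hb
      refine ⟨B, hb, fun c hc => Finset.mem_mul.2 ⟨1, hA, c, hc, one_mul c⟩,
        Subgroup.closure (A : Set G), hfin.toFinset, ?_, fun g => ?_, fun h hh => ?_, ?_⟩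
      · exact (Subgroup.closure_le K).2 hAK
      · rw [Set.Finite.mem_toFinset, SetLike.mem_coe]
      · exact hmul h (by simpa using hh)
      · rw [add_comm]
        refine Nat.add_le_add_left (Finset.card_le_card fun a ha => ?_) _
        simpa using Subgroup.subset_closure (Finset.mem_coe.2 ha)
    · push Not at hstab
      obtain ⟨e, he, a, ha, hae⟩ := hstab
      have hlt : A.filter (fun x => x * e ∈ B) ⊂ A :=
        Finset.filter_ssubset.2 ⟨a, ha, hae⟩
      obtain ⟨C, hbC, hC, hper⟩ := ih _ hlt (B ∪ A.image (fun x => x * e))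
        (fun x hx => hAK x (Finset.mem_filter.1 hx).1)
        (Finset.mem_filter.2 ⟨hA, by rwa [one_mul]⟩) (Finset.mem_union_left _ hb)
      refine ⟨C, hbC, hC.trans ?_, ?_⟩
      · intro z hz
        obtain ⟨x, hx, w, hw, rfl⟩ := Finset.mem_mul.1 hz
        obtain ⟨hxA, hxe⟩ := Finset.mem_filter.1 hx
        rcases Finset.mem_union.1 hw with hw | hw
        · exact Finset.mul_mem_mul hxA hw
        · obtain ⟨v, hv, rfl⟩ := Finset.mem_image.1 hw
          rw [← mul_assoc, hK x (hAK x hxA) v (hAK v hv), mul_assoc]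
          exact Finset.mul_mem_mul hv hxe
      · have hinj : Function.Injective (fun x : G => x * e) := mul_left_injective e
        have e₁ := Finset.card_union_add_card_inter B (A.image (fun x => x * e))
        rw [Finset.card_image_of_injective _ hinj] at e₁
        have e₂ : (B ∩ A.image (fun x => x * e)).card =
            (A.filter (fun x => x * e ∈ B)).card := by
          rw [← Finset.card_image_of_injective (A.filter (fun x => x * e ∈ B)) hinj]
          congr 1
          ext z
          simp only [Finset.mem_inter, Finset.mem_image, Finset.mem_filter]
          constructor
          · rintro ⟨hz, x, hx, rfl⟩
            exact ⟨x, ⟨hx, hz⟩, rfl⟩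
          · rintro ⟨x, ⟨hx, hz⟩, rfl⟩
            exact ⟨hz, x, hx, rfl⟩
        have e₃ : A.card + B.card = (A.filter (fun x => x * e ∈ B)).card +
            (B ∪ A.image (fun x => x * e)).card := by omega
        rwa [e₃]

theorem exists_hasLargePeriod {G : Type*} [Group G] [DecidableEq G]
    {K : Subgroup G} (hK : ∀ g ∈ K, ∀ h ∈ K, g * h = h * g) {A B : Finset G}
    (hAK : ∀ a ∈ A, a ∈ K) {a b : G} (ha : a ∈ A) (hb : b ∈ B) :
    ∃ C, a * b ∈ C ∧ C ⊆ A * B ∧ HasLargePeriod K (A.card + B.card) C := by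
  obtain ⟨C, hbC, hC, L, H, hLK, hL, hstab, hn⟩ :=
    exists_hasLargePeriod_of_one_mem hK b (a⁻¹ • A) B (fun x hx => by
      obtain ⟨y, hy, rfl⟩ := Finset.mem_smul_finset.1 hx
      exact K.mul_mem (K.inv_mem (hAK a ha)) (hAK y hy))
      (Finset.mem_smul_finset.2 ⟨a, ha, by simp⟩) hb
  refine ⟨a • C, Finset.mem_smul_finset.2 ⟨b, hbC, rfl⟩, ?_, L, H, hLK, hL, ?_, ?_⟩
  · intro z hz
    obtain ⟨c, hc, rfl⟩ := Finset.mem_smul_finset.1 hz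
    obtain ⟨x, hx, w, hw, rfl⟩ := Finset.mem_mul.1 (hC hc)
    obtain ⟨y, hy, rfl⟩ := Finset.mem_smul_finset.1 hx
    refine Finset.mem_mul.2 ⟨y, hy, w, hw, ?_⟩
    simp [mul_assoc]
  · intro h hh x hx
    obtain ⟨c, hc, rfl⟩ := Finset.mem_smul_finset.1 hx
    refine Finset.mem_smul_finset.2 ⟨h * c, hstab h hh c hc, ?_⟩
    simp only [smul_eq_mul]
    rw [← mul_assoc, ← mul_assoc, hK a (hAK a ha) h (hLK ((hL h).1 hh))]
  · simpa using hn

theorem hasLargePeriod_mul {G : Type*} [Group G] [DecidableEq G]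
    {K : Subgroup G} (hK : ∀ g ∈ K, ∀ h ∈ K, g * h = h * g) {A B : Finset G}
    (hAK : ∀ a ∈ A, a ∈ K) (hA : A.Nonempty) (hB : B.Nonempty) :
    HasLargePeriod K (A.card + B.card) (A * B) := by
  have key : ∀ S : Finset G, S.Nonempty → S ⊆ A * B →
      ∃ C, S ⊆ C ∧ C ⊆ A * B ∧ HasLargePeriod K (A.card + B.card) C := by
    intro S hS
    induction hS using Finset.Nonempty.cons_induction with
    | singleton s =>
      intro hs
      obtain ⟨a, ha, b, hb, rfl⟩ := Finset.mem_mul.1 (Finset.singleton_subset_iff.1 hs)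
      obtain ⟨C, h₁, h₂, h₃⟩ := exists_hasLargePeriod hK hAK ha hb
      exact ⟨C, Finset.singleton_subset_iff.2 h₁, h₂, h₃⟩
    | cons s S hs hS ih =>
      intro hsS
      rw [Finset.cons_eq_insert, Finset.insert_subset_iff] at hsS
      obtain ⟨C, h₁, h₂, h₃⟩ := ih hsS.2
      obtain ⟨a, ha, b, hb, rfl⟩ := Finset.mem_mul.1 hsS.1
      obtain ⟨D, h₄, h₅, h₆⟩ := exists_hasLargePeriod hK hAK ha hb
      refine ⟨D ∪ C, ?_, Finset.union_subset h₅ h₂, h₆.union hK h₃⟩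
      rw [Finset.cons_eq_insert, Finset.insert_subset_iff]
      exact ⟨Finset.mem_union_left _ h₄, h₁.trans Finset.subset_union_right⟩
  obtain ⟨C, h₁, h₂, h₃⟩ := key (A * B) (hA.mul hB) subset_rfl
  rwa [h₁.antisymm h₂]

theorem stmt_19 {G : Type*} [Group G] (A B : Set G)
    (hAfin : A.Finite) (hBfin : B.Finite)
    (hAne : A.Nonempty) (hBne : B.Nonempty)
    (hcomm : ∀ a ∈ A, ∀ a' ∈ A, a * a' = a' * a) :
    A.ncard + B.ncard ≤ (A * B).ncard + {g : G | g • (A * B) = A * B}.ncard := by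
  classical
  lift A to Finset G using hAfin
  lift B to Finset G using hBfin
  have hK : ∀ g ∈ Subgroup.closure (A : Set G), ∀ h ∈ Subgroup.closure (A : Set G),
      g * h = h * g := by
    intro g hg h hh
    exact Subgroup.closure_induction₂ (p := fun x y _ _ => Commute x y)
      (fun x y hx hy => hcomm x hx y hy) (fun x _ => Commute.one_left x)
      (fun x _ => Commute.one_right x) (fun _ _ _ _ _ _ h₁ h₂ => h₁.mul_left h₂)
      (fun _ _ _ _ _ _ h₁ h₂ => h₁.mul_right h₂) (fun _ _ _ _ h => h.inv_left)
      (fun _ _ _ _ h => h.inv_right) hg hh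
  obtain ⟨L, H, -, hL, hstab, hn⟩ := hasLargePeriod_mul hK
    (fun a ha => Subgroup.subset_closure (Finset.mem_coe.2 ha))
    (Finset.coe_nonempty.1 hAne) (Finset.coe_nonempty.1 hBne)
  rw [← Finset.coe_mul, Set.ncard_coe_finset, Set.ncard_coe_finset, Set.ncard_coe_finset]
  refine hn.trans (Nat.add_le_add_left ?_ _)
  rw [← Set.ncard_coe_finset]
  refine Set.ncard_le_ncard ?_ ?_
  · intro h hh
    have hmem : ∀ g ∈ H, g • (A * B) ⊆ A * B := by
      intro g hg z hz
      obtain ⟨c, hc, rfl⟩ := Finset.mem_smul_finset.1 hz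
      exact hstab g hg c hc
    rw [Set.mem_ofPred_eq, ← Finset.coe_smul_finset, Finset.coe_inj]
    exact Finset.eq_of_subset_of_card_le (hmem h hh) (by simp)
  · obtain ⟨c, hc⟩ := (Finset.coe_nonempty.1 hAne).mul (Finset.coe_nonempty.1 hBne)
    refine Set.Finite.of_finite_image (f := fun g => g * c)
      ((A * B).finite_toSet.subset ?_) (fun _ _ _ _ h => mul_right_cancel h)
    rintro _ ⟨g, hg, rfl⟩
    have hg' : g • ((A * B : Finset G) : Set G) = _ := hg
    rw [← hg']
    exact Set.smul_mem_smul_set hc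
end
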